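/- For every δ > 0 there is an n₀ such that the following holds for every fair complete k-partite graph G on n > n₀ vertices with k ≥ 2. If the edges of G are coloured red and blue and the colouring is not δ-close to a split colouring, then there exist two vertex-disjoint monochromatic cycles of distinct colours (one red and one blue) which together cover all but at most δn vertices of G. -/

import Mathlib

open SimpleGraph Set

/- Convention: colour `true` is red, colour `false` is blue. -/

/-- The subgraph of `G` consisting of the edges of colour `b`. -/
def monoSubgraph {V : Type*} (G : SimpleGraph V) (c : Sym2 V → Bool) (b : Bool) :
    SimpleGraph V :=
  SimpleGraph.fromEdgeSet {e | e ∈ G.edgeSet ∧ c e = b}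

/-- `S` is the vertex set of a (possibly empty, possibly trivial) path of `G`
all of whose edges have colour `b`. -/
def IsMonoPathSet {V : Type*} (G : SimpleGraph V) (c : Sym2 V → Bool) (b : Bool)
    (S : Set V) : Prop :=
  S = ∅ ∨ ∃ (u v : V) (p : G.Walk u v), p.IsPath ∧ (∀ e ∈ p.edges, c e = b) ∧
    S = {x | x ∈ p.support}

/-- `S` is the vertex set of a (possibly degenerate: empty, single vertex or single edge)
cycle of `G` all of whose edges have colour `b`. -/
def IsMonoCycleSet {V : Type*} (G : SimpleGraph V) (c : Sym2 V → Bool) (b : Bool)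
    (S : Set V) : Prop :=
  S = ∅ ∨ (∃ v, S = {v}) ∨ (∃ u v, G.Adj u v ∧ c s(u, v) = b ∧ S = {u, v}) ∨
    ∃ (v : V) (p : G.Walk v v), p.IsCycle ∧ (∀ e ∈ p.edges, c e = b) ∧
      S = {x | x ∈ p.support}

/-- `M` is a matching of `G` in colour `b` which is connected, i.e. all its edges lie in one
connected component of the subgraph formed by the edges of colour `b`. -/
def IsConnMatching {V : Type*} (G : SimpleGraph V) (c : Sym2 V → Bool) (b : Bool)
    (M : Set (Sym2 V)) : Prop :=
  (∀ e ∈ M, e ∈ G.edgeSet ∧ c e = b) ∧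
  (∀ e ∈ M, ∀ f ∈ M, e ≠ f → ∀ x, x ∈ e → x ∉ f) ∧
  (∀ e ∈ M, ∀ f ∈ M, ∀ x, x ∈ e → ∀ y, y ∈ f → (monoSubgraph G c b).Reachable x y)

/-- The set of vertices covered by a set of edges. -/
def matchSupport {V : Type*} (M : Set (Sym2 V)) : Set V := {x | ∃ e ∈ M, x ∈ e}

/-- The colouring `c` of the (bipartite, with classes `U` and `W`) graph `G` is a split
colouring: `U = A ∪ B`, `W = C ∪ D`, the edges between `A,C` and between `B,D` are blue
(`false`), and the edges between `A,D` and between `B,C` are red (`true`). -/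
def IsSplitColouring {V : Type*} (G : SimpleGraph V) (c : Sym2 V → Bool)
    (U W : Set V) : Prop :=
  ∃ A B C D : Set V,
    A ∪ B = U ∧ Disjoint A B ∧ C ∪ D = W ∧ Disjoint C D ∧
    (∀ u v, G.Adj u v →
      (((u ∈ A ∧ v ∈ C) ∨ (u ∈ C ∧ v ∈ A) ∨ (u ∈ B ∧ v ∈ D) ∨ (u ∈ D ∧ v ∈ B)) →
        c s(u, v) = false)) ∧
    (∀ u v, G.Adj u v →
      (((u ∈ A ∧ v ∈ D) ∨ (u ∈ D ∧ v ∈ A) ∨ (u ∈ B ∧ v ∈ C) ∨ (u ∈ C ∧ v ∈ B)) →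
        c s(u, v) = true))

/-- The colouring `c` of `G` is `δ`-close to a split colouring: one can delete at most
`δ|E(G)|` edges so that the remaining graph is bipartite and the colouring on it is a
split colouring. -/
def CloseToSplit {V : Type*} (G : SimpleGraph V) (c : Sym2 V → Bool) (δ : ℝ) : Prop :=
  ∃ F : Set (Sym2 V), F ⊆ G.edgeSet ∧ (F.ncard : ℝ) ≤ δ * (G.edgeSet.ncard : ℝ) ∧
    ∃ U W : Set V, U ∪ W = Set.univ ∧ Disjoint U W ∧
      (∀ u v, (G.deleteEdges F).Adj u v → ((u ∈ U ∧ v ∈ W) ∨ (u ∈ W ∧ v ∈ U))) ∧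
      IsSplitColouring (G.deleteEdges F) c U W

section Structure

open scoped Classical

variable {ι : Type*}

/-- Adjacency in the union of `R` restricted to `C` and `B` restricted to `D`. -/
def UnionAdj (R B : SimpleGraph ι) (C D : Set ι) (x y : ι) : Prop :=
  (x ∈ C ∧ y ∈ C ∧ R.Adj x y) ∨ (x ∈ D ∧ y ∈ D ∧ B.Adj x y)

lemma UnionAdj.swap {R B : SimpleGraph ι} {C D : Set ι} {x y : ι} :
    UnionAdj R B C D x y ↔ UnionAdj B R D C x y :=
  or_comm

variable [Fintype ι]

/-- The vertices `y` outside the class of `x` which are joined to `x` in neither colour. -/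
noncomputable def missing (R B : SimpleGraph ι) (g : ι → ℕ) (x : ι) : Finset ι :=
  Finset.univ.filter fun y => g y ≠ g x ∧ ¬ R.Adj x y ∧ ¬ B.Adj x y

/-- The union of the graphs `R` and `B` is, up to an error `μ`, a fair complete multipartite graph
with classes the fibres of `g`. -/
structure NearlyComplete (R B : SimpleGraph ι) (g : ι → ℕ) (μ : ℝ) : Prop where
  part_le : ∀ j, ((Finset.univ.filter (g · = j)).card : ℝ) ≤ (1 / 2 + μ) * Fintype.card ι
  missing_le : ∀ x, ((missing R B g x).card : ℝ) ≤ μ * Fintype.card ι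

/-- The neighbourhood of `x` with respect to `UnionAdj`. -/
noncomputable def unionNbr (R B : SimpleGraph ι) (C D : Set ι) (x : ι) : Finset ι :=
  Finset.univ.filter fun y => UnionAdj R B C D x y

/-- Every `UnionAdj`-independent set has nearly as many neighbours as elements. -/
def IndepExpanding (R B : SimpleGraph ι) (C D : Set ι) (δ : ℝ) : Prop :=
  ∀ I : Finset ι, (∀ x ∈ I, ∀ y ∈ I, ¬ UnionAdj R B C D x y) →
    (I.card : ℝ) ≤ (I.biUnion (unionNbr R B C D)).card + δ * Fintype.card ι

/-- A set of vertices lying in a single component of `R`. -/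
def ConnectedIn (R : SimpleGraph ι) (C : Set ι) : Prop :=
  ∀ x ∈ C, ∀ y ∈ C, R.Reachable x y

/-- There are connected sets `C` in `R` and `D` in `B` whose union graph is expanding. -/
def HasExpandingPair (R B : SimpleGraph ι) (δ : ℝ) : Prop :=
  ∃ C D : Set ι, ConnectedIn R C ∧ ConnectedIn B D ∧ IndepExpanding R B C D δ

/-- The union of `R` and `B` is bipartite with classes two fibres of `g`, and `X`, `Y` are unions
of components of `R` and of `B`, which split the two classes. -/
def SplitPair (R B : SimpleGraph ι) (g : ι → ℕ) (X Y : Set ι) : Prop :=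
  (∀ x y, R.Adj x y → (x ∈ X ↔ y ∈ X)) ∧ (∀ x y, B.Adj x y → (x ∈ Y ↔ y ∈ Y)) ∧
    ∀ x y, g x ≠ g y → ((x ∈ X ↔ x ∈ Y) ↔ ¬ (y ∈ X ↔ y ∈ Y))

variable {R B : SimpleGraph ι} {g : ι → ℕ} {μ : ℝ}

lemma card_le_add_of_forall_mem_or {α : Type*} {S A T : Finset α}
    (h : ∀ x ∈ S, x ∈ A ∨ x ∈ T) : (S.card : ℝ) ≤ A.card + T.card := by
  have h1 : S ⊆ A ∪ T := fun x hx => Finset.mem_union.2 (h x hx)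
  exact_mod_cast (Finset.card_le_card h1).trans (Finset.card_union_le _ _)

lemma card_add_le_of_disjoint {S T : Finset ι} (h : ∀ x ∈ S, x ∉ T) :
    (S.card : ℝ) + T.card ≤ Fintype.card ι := by
  rw [← Finset.card_univ]
  have h1 : Disjoint S T := Finset.disjoint_left.2 h
  exact_mod_cast (Finset.card_union_of_disjoint h1) ▸ Finset.card_le_card (Finset.subset_univ _)

lemma card_add_card_compl_real (S : Finset ι) :
    (S.card : ℝ) + (Sᶜ).card = Fintype.card ι := by
  exact_mod_cast Finset.card_add_card_compl S

lemma missing_comm (R B : SimpleGraph ι) (g : ι → ℕ) : missing R B g = missing B R g := by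
  ext x y; simp [missing]; tauto

lemma NearlyComplete.swap (h : NearlyComplete R B g μ) : NearlyComplete B R g μ :=
  ⟨h.part_le, fun x => by rw [missing_comm]; exact h.missing_le x⟩

lemma HasExpandingPair.swap {δ : ℝ} (h : HasExpandingPair R B δ) : HasExpandingPair B R δ := by
  obtain ⟨C, D, hC, hD, h⟩ := h
  refine ⟨D, C, hD, hC, fun I hI => ?_⟩
  have h1 : unionNbr B R D C = unionNbr R B C D := by
    ext x y; simp [unionNbr, UnionAdj.swap (R := R)]
  rw [h1]
  exact h I fun x hx y hy hxy => hI x hx y hy (UnionAdj.swap.1 hxy)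

lemma NearlyComplete.le_card (h : NearlyComplete R B g μ) (x : ι) {S : Finset ι}
    (hS : ∀ y, g y ≠ g x → y ∉ missing R B g x → y ∈ S) :
    (1 / 2 - 2 * μ) * Fintype.card ι ≤ S.card := by
  have h1 := card_le_add_of_forall_mem_or (S := Finset.univ)
    (A := Finset.univ.filter (g · = g x)) (T := missing R B g x ∪ S) (fun y _ => by
      by_cases h1 : g y = g x
      · simp [h1]
      · right
        by_cases h2 : y ∈ missing R B g x
        · simp [h2]
        · simp [hS y h1 h2])
  have h2 : ((missing R B g x ∪ S).card : ℝ) ≤ (missing R B g x).card + S.card := by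
    exact_mod_cast Finset.card_union_le _ _
  have h3 := h.part_le (g x)
  have h4 := h.missing_le x
  rw [Finset.card_univ] at h1
  linarith

lemma adj_of_notMem_missing {x y : ι} (h : g y ≠ g x) (h' : y ∉ missing R B g x) :
    R.Adj x y ∨ B.Adj x y := by
  simp [missing] at h'
  tauto

lemma subset_missing_union_part {x : ι} {S : Finset ι}
    (hS : ∀ y ∈ S, ¬ R.Adj x y ∧ ¬ B.Adj x y) :
    ∀ y ∈ S, g y = g x ∨ y ∈ missing R B g x := by
  intro y hy
  by_contra! h
  have := adj_of_notMem_missing h.1 h.2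
  have := hS y hy
  tauto

/-- Two large sets with no edges between them lie in a common class. -/
lemma NearlyComplete.same_part (h : NearlyComplete R B g μ) {S T : Finset ι}
    (hST : ∀ x ∈ S, ∀ y ∈ T, ¬ R.Adj x y ∧ ¬ B.Adj x y)
    (hS : 2 * μ * Fintype.card ι < S.card) (hT : 2 * μ * Fintype.card ι < T.card) :
    ∃ j, ∀ x, x ∈ S ∨ x ∈ T → g x = j := by
  have key : ∀ {S T : Finset ι}, (∀ x ∈ S, ∀ y ∈ T, ¬ R.Adj x y ∧ ¬ B.Adj x y) →
      2 * μ * Fintype.card ι < T.card → ∀ x ∈ S, ∀ x' ∈ S, g x = g x' := by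
    intro S T hST hT x hx x' hx'
    by_contra hne
    have h1 := card_le_add_of_forall_mem_or (S := T) (A := missing R B g x)
      (T := missing R B g x') (fun y hy => by
        have h1 := subset_missing_union_part (g := g) (hST x hx) y hy
        have h2 := subset_missing_union_part (g := g) (hST x' hx') y hy
        rcases h1 with h1 | h1
        · rcases h2 with h2 | h2
          · exact absurd (h1.symm.trans h2) hne
          · exact Or.inr h2
        · exact Or.inl h1)
    have h2 := h.missing_le x
    have h3 := h.missing_le x'
    linarith
  have hTS : ∀ x ∈ T, ∀ y ∈ S, ¬ R.Adj x y ∧ ¬ B.Adj x y := fun x hx y hy => by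
    rw [R.adj_comm, B.adj_comm]; exact hST y hy x hx
  have hμ : ∀ x : ι, 0 ≤ μ * Fintype.card ι := fun x => (Nat.cast_nonneg _).trans (h.missing_le x)
  rcases S.eq_empty_or_nonempty with rfl | ⟨s, hs⟩
  · rcases T.eq_empty_or_nonempty with rfl | ⟨t, ht⟩
    · exact ⟨0, by simp⟩
    · have := hμ t
      simp at hS; nlinarith
  · have h0 := hμ s
    have : ∃ t ∈ T, g t = g s := by
      by_contra! hne
      have h1 : (T.card : ℝ) ≤ (missing R B g s).card := by
        exact_mod_cast Finset.card_le_card fun y hy =>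
          (subset_missing_union_part (g := g) (hST s hs) y hy).resolve_left (hne y hy)
      have := h.missing_le s
      linarith
    obtain ⟨t, ht, hts⟩ := this
    refine ⟨g s, ?_⟩
    rintro x (hx | hx)
    · exact key hST hT x hx s hs
    · exact (key hTS hS x hx t ht).trans hts

/-- If `T` has only `B`-edges to `W` then `W` lies in a single component of `B`. -/
lemma NearlyComplete.reachable_of_complete (h : NearlyComplete R B g μ) {T W : Finset ι}
    (hT : μ * Fintype.card ι < T.card) (hW : 2 * μ * Fintype.card ι < W.card)
    (hTW : ∀ t ∈ T, ∀ w ∈ W, g w ≠ g t ∧ ¬ R.Adj t w) :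
    ∀ w ∈ W, ∀ w' ∈ W, B.Reachable w w' := by
  have hnb : ∀ w ∈ W, ∃ t ∈ T, B.Adj w t := by
    intro w hw
    by_contra! hne
    have h1 : (T.card : ℝ) ≤ (missing R B g w).card := by
      refine mod_cast Finset.card_le_card fun t ht => ?_
      simp only [missing, Finset.mem_filter, Finset.mem_univ, true_and]
      exact ⟨(hTW t ht w hw).1.symm, fun h => (hTW t ht w hw).2 h.symm, hne t ht⟩
    have := h.missing_le w
    linarith
  intro w hw w' hw'
  obtain ⟨t, ht, hwt⟩ := hnb w hw
  obtain ⟨t', ht', hwt'⟩ := hnb w' hw'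
  have : ∃ v ∈ W, B.Adj t v ∧ B.Adj t' v := by
    by_contra! hne
    have h1 := card_le_add_of_forall_mem_or (S := W) (A := missing R B g t)
      (T := missing R B g t') (fun v hv => by
        by_contra! hv'
        have h1 := (adj_of_notMem_missing (hTW t ht v hv).1 hv'.1).resolve_left (hTW t ht v hv).2
        have h2 := (adj_of_notMem_missing (hTW t' ht' v hv).1 hv'.2).resolve_left
          (hTW t' ht' v hv).2
        exact hne v hv h1 h2)
    have := h.missing_le t
    have := h.missing_le t'
    linarith
  obtain ⟨v, -, h1, h2⟩ := this
  exact hwt.reachable.trans (h1.reachable.trans (h2.symm.reachable.trans hwt'.symm.reachable))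

/-- A neighbourhood of almost half of the vertices prevents an independent set from being an
obstruction. -/
lemma card_le_of_large_nbr {δ c : ℝ} {C D : Set ι} {I S : Finset ι}
    (hI : ∀ x ∈ I, ∀ y ∈ I, ¬ UnionAdj R B C D x y)
    (hS : S ⊆ I.biUnion (unionNbr R B C D)) (hc : (1 / 2 - c) * Fintype.card ι ≤ S.card)
    (hδ : 2 * c ≤ δ) :
    (I.card : ℝ) ≤ (I.biUnion (unionNbr R B C D)).card + δ * Fintype.card ι := by
  have h1 := card_add_le_of_disjoint (S := I) (T := I.biUnion (unionNbr R B C D)) (by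
    intro x hx hx'
    simp only [Finset.mem_biUnion, unionNbr, Finset.mem_filter, Finset.mem_univ, true_and] at hx'
    obtain ⟨y, hy, hxy⟩ := hx'
    exact hI y hy x hx hxy)
  have h2 : (S.card : ℝ) ≤ (I.biUnion (unionNbr R B C D)).card := mod_cast Finset.card_le_card hS
  have h3 : (0 : ℝ) ≤ Fintype.card ι := by positivity
  nlinarith

lemma NearlyComplete.pos_of_nonempty [Nonempty ι] (h : NearlyComplete R B g μ) : 0 ≤ μ := by
  obtain ⟨x⟩ := ‹Nonempty ι›
  have h1 := (Nat.cast_nonneg _).trans (h.missing_le x)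
  have h2 : (0 : ℝ) < Fintype.card ι := by exact_mod_cast Fintype.card_pos_iff.2 ⟨x⟩
  by_contra! hμ
  nlinarith

lemma NearlyComplete.hasExpandingPair_of_small_cell [Nonempty ι] (h : NearlyComplete R B g μ)
    {δ γ : ℝ} (hδ : 20 * μ ≤ δ) (hγ : 5 * μ ≤ γ) (hγ0 : 0 < γ) (hμ : μ ≤ 1 / 20) {X Y : Finset ι}
    (hX : ∀ x y, R.Adj x y → (x ∈ X ↔ y ∈ X)) (hY : ∀ x y, B.Adj x y → (x ∈ Y ↔ y ∈ Y))
    (hXc : γ * Fintype.card ι ≤ (Xᶜ).card) (hYc : γ * Fintype.card ι ≤ (Yᶜ).card)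
    (hQ : ((Xᶜ ∩ Yᶜ).card : ℝ) ≤ 2 * μ * Fintype.card ι) : HasExpandingPair R B δ := by
  have hμ0 := h.pos_of_nonempty
  have hN : (0 : ℝ) < Fintype.card ι := by exact_mod_cast Fintype.card_pos
  have hSc : 2 * μ * Fintype.card ι < (X ∩ Yᶜ).card := by
    have := card_le_add_of_forall_mem_or (S := Yᶜ) (A := X ∩ Yᶜ) (T := Xᶜ ∩ Yᶜ) (by
      intro x hx; simp only [Finset.mem_inter, Finset.mem_compl] at *; tauto)
    nlinarith
  have hTc : 2 * μ * Fintype.card ι < (Xᶜ ∩ Y).card := by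
    have := card_le_add_of_forall_mem_or (S := Xᶜ) (A := Xᶜ ∩ Y) (T := Xᶜ ∩ Yᶜ) (by
      intro x hx; simp only [Finset.mem_inter, Finset.mem_compl] at *; tauto)
    nlinarith
  obtain ⟨j, hj⟩ := h.same_part (S := X ∩ Yᶜ) (T := Xᶜ ∩ Y) (by
    intro x hx y hy
    simp only [Finset.mem_inter, Finset.mem_compl] at hx hy
    exact ⟨fun e => hy.1 ((hX x y e).1 hx.1), fun e => hx.2 ((hY x y e).2 hy.2)⟩) hSc hTc
  set W : Finset ι := (X ∩ Y).filter (g · ≠ j) with hWdef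
  have hWm : ∀ w, w ∈ W ↔ w ∈ X ∧ w ∈ Y ∧ g w ≠ j := by simp [hWdef, and_assoc]
  have hcov : ∀ w, g w ≠ j → w ∉ Xᶜ ∩ Yᶜ → w ∈ W := by
    intro w hw hw'
    rw [hWm]
    have := hj w
    simp only [Finset.mem_inter, Finset.mem_compl] at this hw'
    tauto
  have hWc : (1 / 2 - 3 * μ) * Fintype.card ι ≤ W.card := by
    have h1 := card_le_add_of_forall_mem_or (S := Finset.univ)
      (A := Finset.univ.filter (g · = j)) (T := (Xᶜ ∩ Yᶜ) ∪ W) (fun y _ => by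
        by_cases h1 : g y = j
        · simp [h1]
        · right
          by_cases h2 : y ∈ Xᶜ ∩ Yᶜ
          · exact Finset.mem_union_left _ h2
          · exact Finset.mem_union_right _ (hcov y h1 h2))
    have h2 : (((Xᶜ ∩ Yᶜ) ∪ W).card : ℝ) ≤ (Xᶜ ∩ Yᶜ).card + W.card := by
      exact_mod_cast Finset.card_union_le _ _
    have h3 := h.part_le j
    rw [Finset.card_univ] at h1
    linarith
  have hWc' : 2 * μ * Fintype.card ι < W.card := by nlinarith
  have hconR := h.swap.reachable_of_complete (T := X ∩ Yᶜ) (W := W) (by nlinarith) hWc' (by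
    intro t ht w hw
    have h1 := hj t (Or.inl ht)
    rw [hWm] at hw
    simp only [Finset.mem_inter, Finset.mem_compl] at ht
    exact ⟨by rw [h1]; exact hw.2.2, fun e => ht.2 ((hY t w e).2 hw.2.1)⟩)
  have hconB := h.reachable_of_complete (T := Xᶜ ∩ Y) (W := W) (by nlinarith) hWc' (by
    intro t ht w hw
    have h1 := hj t (Or.inr ht)
    rw [hWm] at hw
    simp only [Finset.mem_inter, Finset.mem_compl] at ht
    exact ⟨by rw [h1]; exact hw.2.2, fun e => ht.1 ((hX t w e).2 hw.1)⟩)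
  obtain ⟨w0, hw0⟩ : W.Nonempty := by
    rw [← Finset.card_pos]
    have : (0 : ℝ) < W.card := by nlinarith
    exact_mod_cast this
  refine ⟨{x | R.Reachable w0 x}, {x | B.Reachable w0 x}, fun x hx y hy => hx.symm.trans hy,
    fun x hx y hy => hx.symm.trans hy, fun I hI => ?_⟩
  have hadj : ∀ w ∈ W, ∀ y, R.Adj w y ∨ B.Adj w y →
      UnionAdj R B {x | R.Reachable w0 x} {x | B.Reachable w0 x} w y := by
    rintro w hw y (e | e)
    · exact Or.inl ⟨hconR w0 hw0 w hw, (hconR w0 hw0 w hw).trans e.reachable, e⟩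
    · exact Or.inr ⟨hconB w0 hw0 w hw, (hconB w0 hw0 w hw).trans e.reachable, e⟩
  by_cases hIW : ∃ w ∈ I, w ∈ W
  · obtain ⟨w, hwI, hwW⟩ := hIW
    refine card_le_of_large_nbr (c := 2 * μ) (S := Finset.univ.filter
      fun y => g y ≠ g w ∧ y ∉ missing R B g w) hI (fun y hy => ?_) (h.le_card w ?_) (by linarith)
    · simp only [Finset.mem_filter, Finset.mem_univ, true_and] at hy
      refine Finset.mem_biUnion.2 ⟨w, hwI, ?_⟩
      simpa [unionNbr] using hadj w hwW y (adj_of_notMem_missing hy.1 hy.2)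
    · intro y h1 h2
      simp [h1, h2]
  · by_cases hIU : ∃ u ∈ I, g u = j
    · obtain ⟨u, huI, huj⟩ := hIU
      refine card_le_of_large_nbr (c := 4 * μ) (S := W \ missing R B g u) hI
        (fun y hy => ?_) ?_ (by linarith)
      · rw [Finset.mem_sdiff] at hy
        refine Finset.mem_biUnion.2 ⟨u, huI, ?_⟩
        have h1 := adj_of_notMem_missing (by rw [huj]; exact ((hWm y).1 hy.1).2.2) hy.2
        have h2 := hadj y hy.1 u (by rwa [R.adj_comm, B.adj_comm])
        simp only [unionNbr, Finset.mem_filter, Finset.mem_univ, true_and]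
        rcases h2 with h2 | h2
        · exact Or.inl ⟨h2.2.1, h2.1, h2.2.2.symm⟩
        · exact Or.inr ⟨h2.2.1, h2.1, h2.2.2.symm⟩
      · have h1 := card_le_add_of_forall_mem_or (S := W) (A := W \ missing R B g u)
          (T := missing R B g u) (fun x hx => by
            simp only [Finset.mem_sdiff]; tauto)
        have h2 := h.missing_le u
        linarith
    · push Not at hIW hIU
      have h1 : (I.card : ℝ) ≤ (Xᶜ ∩ Yᶜ).card := by
        refine mod_cast Finset.card_le_card fun x hx => ?_
        by_contra hx'
        exact hIW x hx (hcov x (hIU x hx) hx')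
      have h2 : (0 : ℝ) ≤ (I.biUnion (unionNbr R B {x | R.Reachable w0 x}
        {x | B.Reachable w0 x})).card := by positivity
      nlinarith

/-- Two proper cuts, one in each colour, either split the graph or give an expanding pair. -/
lemma NearlyComplete.of_cuts [Nonempty ι] (h : NearlyComplete R B g μ)
    {δ γ : ℝ} (hδ : 20 * μ ≤ δ) (hγ : 5 * μ ≤ γ) (hγ0 : 0 < γ) (hμ : μ ≤ 1 / 20) {X Y : Finset ι}
    (hX : ∀ x y, R.Adj x y → (x ∈ X ↔ y ∈ X)) (hY : ∀ x y, B.Adj x y → (x ∈ Y ↔ y ∈ Y))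
    (hX1 : γ * Fintype.card ι ≤ X.card) (hY1 : γ * Fintype.card ι ≤ Y.card)
    (hXc : γ * Fintype.card ι ≤ (Xᶜ).card) (hYc : γ * Fintype.card ι ≤ (Yᶜ).card) :
    HasExpandingPair R B δ ∨ ∃ X Y, SplitPair R B g X Y := by
  have hX' : ∀ x y, R.Adj x y → (x ∈ Xᶜ ↔ y ∈ Xᶜ) := fun x y e => by simp [hX x y e]
  have hY' : ∀ x y, B.Adj x y → (x ∈ Yᶜ ↔ y ∈ Yᶜ) := fun x y e => by simp [hY x y e]
  by_cases h1 : ((Xᶜ ∩ Yᶜ).card : ℝ) ≤ 2 * μ * Fintype.card ι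
  · exact Or.inl (h.hasExpandingPair_of_small_cell hδ hγ hγ0 hμ hX hY hXc hYc h1)
  by_cases h2 : ((X ∩ Yᶜ).card : ℝ) ≤ 2 * μ * Fintype.card ι
  · exact Or.inl (h.hasExpandingPair_of_small_cell hδ hγ hγ0 hμ hX' hY (by simpa) hYc (by simpa))
  by_cases h3 : ((Xᶜ ∩ Y).card : ℝ) ≤ 2 * μ * Fintype.card ι
  · exact Or.inl (h.hasExpandingPair_of_small_cell hδ hγ hγ0 hμ hX hY' hXc (by simpa) (by simpa))
  by_cases h4 : ((X ∩ Y).card : ℝ) ≤ 2 * μ * Fintype.card ι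
  · exact Or.inl (h.hasExpandingPair_of_small_cell hδ hγ hγ0 hμ hX' hY' (by simpa) (by simpa)
      (by simpa))
  push Not at h1 h2 h3 h4
  right
  refine ⟨X, Y, fun x y e => by simpa using hX x y e, fun x y e => by simpa using hY x y e, ?_⟩
  obtain ⟨j, hj⟩ := h.same_part (S := X ∩ Y) (T := Xᶜ ∩ Yᶜ) (by
    intro x hx y hy
    simp only [Finset.mem_inter, Finset.mem_compl] at hx hy
    exact ⟨fun e => hy.1 ((hX x y e).1 hx.1), fun e => hy.2 ((hY x y e).1 hx.2)⟩) h4 h1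
  obtain ⟨j', hj'⟩ := h.same_part (S := X ∩ Yᶜ) (T := Xᶜ ∩ Y) (by
    intro x hx y hy
    simp only [Finset.mem_inter, Finset.mem_compl] at hx hy
    exact ⟨fun e => hy.1 ((hX x y e).1 hx.1), fun e => hx.2 ((hY x y e).2 hy.2)⟩) h2 h3
  have key : ∀ x, ((x ∈ X ↔ x ∈ Y) ∧ g x = j) ∨ (¬ (x ∈ X ↔ x ∈ Y) ∧ g x = j') := by
    intro x
    have h1 := hj x
    have h2 := hj' x
    simp only [Finset.mem_inter, Finset.mem_compl] at h1 h2
    tauto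
  have hne : j ≠ j' := by
    rintro rfl
    have h1 := h.part_le j
    rw [Finset.filter_true_of_mem (fun x _ => by have := key x; tauto), Finset.card_univ] at h1
    have hN : (0 : ℝ) < Fintype.card ι := by exact_mod_cast Fintype.card_pos
    nlinarith
  intro x y hxy
  have h1 := key x
  have h2 := key y
  simp only [Finset.mem_coe]
  by_cases hx : (x ∈ X ↔ x ∈ Y) <;> by_cases hy : (y ∈ X ↔ y ∈ Y) <;>
    simp only [hx, hy, true_and, false_and, not_true, not_false_eq_true, or_false, false_or] at *
  · exact absurd (h1.trans h2.symm) hxy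
  · exact absurd (h1.trans h2.symm) hxy

end Structure

section LargeComponent

open scoped Classical

variable {ι : Type*} [Fintype ι] {R B : SimpleGraph ι} {g : ι → ℕ} {μ : ℝ}

/-- `E` contains most vertices, or more vertices of some class than lie outside both. -/
def Dominating (g : ι → ℕ) (δ : ℝ) (E : Finset ι) : Prop :=
  ((Eᶜ).card : ℝ) < E.card - δ * Fintype.card ι ∨
    ∃ j, (((Eᶜ).filter (g · ≠ j)).card : ℝ) <
      (E.filter (g · = j)).card - δ * Fintype.card ι

lemma card_filter_add_card_filter_le {α : Type*} {E E' F : Finset α}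
    {p : α → Prop} [DecidablePred p] (hE : Disjoint E E') (h : ∀ x, p x → x ∈ E ∨ x ∈ E' → x ∈ F) :
    ((E.filter p).card : ℝ) + (E'.filter p).card ≤ F.card := by
  have h1 : Disjoint (E.filter p) (E'.filter p) := Finset.disjoint_filter_filter hE
  have h2 : E.filter p ∪ E'.filter p ⊆ F := by
    intro x hx
    simp only [Finset.mem_union, Finset.mem_filter] at hx
    have := h x
    tauto
  exact_mod_cast (Finset.card_union_of_disjoint h1) ▸ Finset.card_le_card h2

lemma Dominating.not_disjoint (h : NearlyComplete R B g μ) {δ : ℝ} (hδ : 2 * μ < δ) (hδ0 : 0 < δ)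
    {E E' : Finset ι} (hE : Dominating g δ E) (hE' : Dominating g δ E') : ¬ Disjoint E E' := by
  intro hd
  have hN : (0 : ℝ) ≤ Fintype.card ι := by positivity
  have hδN : 0 ≤ δ * Fintype.card ι := by positivity
  have hμN : 2 * (μ * Fintype.card ι) ≤ δ * Fintype.card ι := by nlinarith
  have mixed : ∀ {E E' : Finset ι}, Disjoint E E' →
      ((Eᶜ).card : ℝ) < E.card - δ * Fintype.card ι →
      (∃ j, (((E'ᶜ).filter (g · ≠ j)).card : ℝ) <
        (E'.filter (g · = j)).card - δ * Fintype.card ι) → False := by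
    rintro E E' hd h1 ⟨j, h2⟩
    have h3 := card_add_card_compl_real E
    have h4 := card_le_add_of_forall_mem_or (S := E) (A := E.filter (g · = j))
      (T := (E'ᶜ).filter (g · ≠ j)) (fun x hx => by
        have := Finset.disjoint_left.1 hd hx
        simp only [Finset.mem_filter, Finset.mem_compl]; tauto)
    have h5 := card_filter_add_card_filter_le (p := (g · = j))
      (F := Finset.univ.filter (g · = j)) hd (by simp +contextual)
    have h6 := h.part_le j
    linarith
  rcases hE with h1 | ⟨j, h1⟩
  · rcases hE' with h2 | h2
    · have h3 := card_add_card_compl_real E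
      have h4 := card_add_card_compl_real E'
      have h5 := card_add_le_of_disjoint (S := E) (T := E') (fun _ h => Finset.disjoint_left.1 hd h)
      linarith
    · exact mixed hd h1 h2
  · rcases hE' with h2 | ⟨j', h2⟩
    · exact mixed hd.symm h2 ⟨j, h1⟩
    · by_cases hj : j = j'
      · subst hj
        have h5 := card_filter_add_card_filter_le (p := (g · = j))
          (F := Finset.univ.filter (g · = j)) hd (by simp +contextual)
        have h6 := h.part_le j
        have h7 := card_le_add_of_forall_mem_or (S := Finset.univ.filter (g · ≠ j))
          (A := (Eᶜ).filter (g · ≠ j)) (T := (E'ᶜ).filter (g · ≠ j)) (fun x hx => by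
            have := fun h : x ∈ E => Finset.disjoint_left.1 hd h
            simp only [Finset.mem_filter, Finset.mem_compl, Finset.mem_univ] at *; tauto)
        have h8 := card_add_card_compl_real (Finset.univ.filter (g · = j))
        rw [Finset.compl_filter] at h8
        linarith
      · have h3 : ((E.filter (g · = j)).card : ℝ) ≤ ((E'ᶜ).filter (g · ≠ j')).card := by
          refine mod_cast Finset.card_le_card fun x hx => ?_
          have := fun h : x ∈ E => Finset.disjoint_left.1 hd h
          simp only [Finset.mem_filter, Finset.mem_compl] at *
          exact ⟨this hx.1, fun e => hj (hx.2.symm.trans e)⟩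
        have h4 : ((E'.filter (g · = j')).card : ℝ) ≤ ((Eᶜ).filter (g · ≠ j)).card := by
          refine mod_cast Finset.card_le_card fun x hx => ?_
          have := fun h : x ∈ E => Finset.disjoint_left.1 hd h
          simp only [Finset.mem_filter, Finset.mem_compl] at *
          exact ⟨fun e => this e hx.1, fun e => hj (e.symm.trans hx.2)⟩
        linarith

/-- The component of `x` as a finset. -/
noncomputable def component (B : SimpleGraph ι) (x : ι) : Finset ι :=
  Finset.univ.filter fun y => B.Reachable x y

lemma mem_component {x y : ι} : y ∈ component B x ↔ B.Reachable x y := by simp [component]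

lemma connectedIn_component (x : ι) : ConnectedIn B (component B x : Set ι) := fun y hy z hz => by
  rw [Finset.mem_coe, mem_component] at hy hz
  exact hy.symm.trans hz

lemma disjoint_component {x y : ι} (h : ¬ B.Reachable x y) :
    Disjoint (component B x) (component B y) := by
  refine Finset.disjoint_left.2 fun z hz hz' => h ?_
  rw [mem_component] at hz hz'
  exact hz.trans hz'.symm

lemma NearlyComplete.hasExpandingPair_of_large_component [Nonempty ι]
    (h : NearlyComplete R B g μ) {δ γ : ℝ} (hδ : 20 * μ + γ < δ) (hγ : 0 ≤ γ) (x₀ : ι)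
    (hC : (1 - γ) * Fintype.card ι ≤ (component R x₀).card) : HasExpandingPair R B δ := by
  have hμ0 := h.pos_of_nonempty
  have hN : (0 : ℝ) < Fintype.card ι := by exact_mod_cast Fintype.card_pos
  set δ' : ℝ := δ - γ - 3 * μ with hδ'
  have hδ'μ : 2 * μ < δ' := by linarith
  set C : Finset ι := component R x₀ with hCdef
  obtain ⟨D, hDcon, hDcl, hDdom⟩ : ∃ D : Finset ι, ConnectedIn B (D : Set ι) ∧
      (∀ x ∈ D, ∀ y, B.Adj x y → y ∈ D) ∧
      ∀ y, y ∉ D → ¬ Dominating g δ' (component B y) := by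
    by_cases hd : ∃ y, Dominating g δ' (component B y)
    · obtain ⟨z, hz⟩ := hd
      refine ⟨component B z, connectedIn_component z, fun x hx y hxy => ?_, fun y hy hyd => ?_⟩
      · rw [mem_component] at *
        exact hx.trans hxy.reachable
      · rw [mem_component] at hy
        exact hz.not_disjoint h hδ'μ (by linarith) hyd (disjoint_component hy)
    · push Not at hd
      exact ⟨∅, fun x hx => by simp at hx, fun x hx => by simp at hx, fun y _ => hd y⟩
  refine ⟨C, D, connectedIn_component x₀, hDcon, fun I hI => ?_⟩
  by_contra! hlt
  set Nb := I.biUnion (unionNbr R B (C : Set ι) D) with hNb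
  have hCcl : ∀ x ∈ C, ∀ y, R.Adj x y → y ∈ C := fun x hx y hxy => by
    rw [hCdef, mem_component] at *
    exact hx.trans hxy.reachable
  have hNbR : ∀ x ∈ I, x ∈ C → ∀ y, R.Adj x y → y ∈ Nb := fun x hx hxC y hxy => by
    refine Finset.mem_biUnion.2 ⟨x, hx, ?_⟩
    simp only [unionNbr, Finset.mem_filter, Finset.mem_univ, true_and]
    exact Or.inl ⟨hxC, hCcl x hxC y hxy, hxy⟩
  have hNbB : ∀ x ∈ I, x ∈ D → ∀ y, B.Adj x y → y ∈ Nb := fun x hx hxD y hxy => by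
    refine Finset.mem_biUnion.2 ⟨x, hx, ?_⟩
    simp only [unionNbr, Finset.mem_filter, Finset.mem_univ, true_and]
    exact Or.inr ⟨hxD, hDcl x hxD y hxy, hxy⟩
  have hINb : ∀ x ∈ I, x ∉ Nb := by
    intro x hx hx'
    simp only [hNb, Finset.mem_biUnion, unionNbr, Finset.mem_filter, Finset.mem_univ,
      true_and] at hx'
    obtain ⟨y, hy, hxy⟩ := hx'
    exact hI y hy x hx hxy
  have hlarge : ∀ S : Finset ι, S ⊆ Nb → (1 / 2 - 3 * μ) * Fintype.card ι ≤ S.card → False :=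
    fun S hS hSc => by
      have := card_le_of_large_nbr hI hS hSc (δ := δ) (by linarith)
      linarith
  set J := I ∩ C with hJ
  have hJm : ∀ x, x ∈ J ↔ x ∈ I ∧ x ∈ C := by simp [hJ]
  have hJc : (I.card : ℝ) ≤ J.card + γ * Fintype.card ι := by
    have h1 := card_le_add_of_forall_mem_or (S := I) (A := J) (T := Cᶜ) (fun x hx => by
      rw [hJm, Finset.mem_compl]; tauto)
    have h2 := card_add_card_compl_real C
    linarith
  have hbound : (Nb.card : ℝ) < J.card - (δ - γ) * Fintype.card ι := by linarith
  have hJD : ∀ x ∈ J, x ∉ D := by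
    intro x hx hxD
    rw [hJm] at hx
    refine hlarge (Finset.univ.filter fun y => g y ≠ g x ∧ y ∉ missing R B g x) (fun y hy => ?_) ?_
    · simp only [Finset.mem_filter, Finset.mem_univ, true_and] at hy
      exact (adj_of_notMem_missing hy.1 hy.2).elim (hNbR x hx.1 hx.2 y) (hNbB x hx.1 hxD y)
    · have := h.le_card x (S := Finset.univ.filter fun y => g y ≠ g x ∧ y ∉ missing R B g x)
        (fun y h1 h2 => by simp [h1, h2])
      nlinarith
  have hout : ∀ x ∈ J, ∀ y, g y ≠ g x → y ∉ missing R B g x → y ∉ Nb → y ∈ component B x := by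
    intro x hx y h1 h2 h3
    rw [hJm] at hx
    rcases adj_of_notMem_missing h1 h2 with e | e
    · exact absurd (hNbR x hx.1 hx.2 y e) h3
    · rw [mem_component]; exact e.reachable
  obtain ⟨x, hx⟩ : J.Nonempty := by
    rw [← Finset.card_pos]
    have h1 : (0 : ℝ) ≤ Nb.card := by positivity
    have h2 : (0 : ℝ) < J.card := by nlinarith
    exact_mod_cast h2
  have hmx := h.missing_le x
  by_cases hall : ∀ y ∈ J, y ∈ component B x
  · refine hDdom x (hJD x hx) ?_
    by_cases hU : ∀ y ∈ J, g y = g x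
    · refine Or.inr ⟨g x, ?_⟩
      have h1 := card_le_add_of_forall_mem_or (S := ((component B x)ᶜ).filter (g · ≠ g x))
        (A := Nb) (T := missing R B g x) (fun y hy => by
          simp only [Finset.mem_filter, Finset.mem_compl] at hy
          by_contra! hy'
          exact hy.1 (hout x hx y hy.2 hy'.2 hy'.1))
      have h2 : (J.card : ℝ) ≤ ((component B x).filter (g · = g x)).card := by
        refine mod_cast Finset.card_le_card fun y hy => ?_
        exact Finset.mem_filter.2 ⟨hall y hy, hU y hy⟩
      rw [hδ']
      nlinarith
    · push Not at hU
      obtain ⟨y, hy, hyx⟩ := hU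
      have hcomp : component B y = component B x := by
        ext z
        have := hall y hy
        simp only [mem_component] at *
        exact ⟨this.trans, this.symm.trans⟩
      left
      have h1 := card_le_add_of_forall_mem_or (S := (component B x)ᶜ)
        (A := Nb) (T := missing R B g x ∪ missing R B g y) (fun z hz => by
          rw [Finset.mem_compl] at hz
          by_contra! hz'
          rw [Finset.mem_union, not_or] at hz'
          by_cases hzx : g z = g x
          · exact hz (hcomp ▸ hout y hy z (by rw [hzx]; exact hyx.symm) hz'.2.2 hz'.1)
          · exact hz (hout x hx z hzx hz'.2.1 hz'.1))
      have h2 : (J.card : ℝ) ≤ (component B x).card := mod_cast Finset.card_le_card hall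
      have h3 : ((missing R B g x ∪ missing R B g y).card : ℝ) ≤
        (missing R B g x).card + (missing R B g y).card := mod_cast Finset.card_union_le _ _
      have hmy := h.missing_le y
      rw [hδ']
      nlinarith
  · push Not at hall
    obtain ⟨y, hy, hyx⟩ := hall
    have hne : ∀ x ∈ J, ∀ y ∈ J, y ∉ component B x → g x ≠ g y := by
      intro x hx y hy hyx hg
      refine hlarge Nb subset_rfl ?_
      have h1 := card_le_add_of_forall_mem_or (S := (Finset.univ.filter (g · = g x))ᶜ)
        (A := Nb) (T := missing R B g x ∪ missing R B g y) (fun z hz => by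
          by_contra! hz'
          simp only [Finset.mem_union, not_or, Finset.mem_compl, Finset.mem_filter,
            Finset.mem_univ, true_and] at hz hz'
          have h1 := hout x hx z hz hz'.2.1 hz'.1
          have h2 := hout y hy z (by rw [← hg]; exact hz) hz'.2.2 hz'.1
          rw [mem_component] at *
          exact hyx (h1.trans h2.symm))
      have h3 : ((missing R B g x ∪ missing R B g y).card : ℝ) ≤
        (missing R B g x).card + (missing R B g y).card := mod_cast Finset.card_union_le _ _
      have h4 := h.missing_le x
      have h5 := h.missing_le y
      have h6 := card_add_card_compl_real (Finset.univ.filter (g · = g x))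
      have h7 := h.part_le (g x)
      linarith
    have hsub : ∀ x ∈ J, ∀ z ∈ J, z ∈ component B x ∨ z ∈ missing R B g x := by
      intro x hx z hz
      by_contra! hz'
      exact hz'.1 (hout x hx z (hne x hx z hz hz'.1).symm hz'.2 (hINb z ((hJm z).1 hz).1))
    have h1 := card_le_add_of_forall_mem_or (S := J)
      (A := missing R B g x) (T := missing R B g y) (fun z hz => by
        by_contra! hz'
        have h1 := (hsub x hx z hz).resolve_right hz'.1
        have h2 := (hsub y hy z hz).resolve_right hz'.2
        rw [mem_component] at *
        exact hyx (h1.trans h2.symm))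
    have hmy := h.missing_le y
    have h0 : (0 : ℝ) ≤ Nb.card := by positivity
    nlinarith

/-- A graph without a component containing almost all vertices has a balanced cut. -/
lemma exists_cut [Nonempty ι] {γ : ℝ} (hγ : γ ≤ 1 / 3)
    (h : ∀ x, ((component R x).card : ℝ) < (1 - γ) * Fintype.card ι) :
    ∃ X : Finset ι, (∀ x y, R.Adj x y → (x ∈ X ↔ y ∈ X)) ∧ γ * Fintype.card ι ≤ X.card ∧
      γ * Fintype.card ι ≤ (Xᶜ).card := by
  have hN : (0 : ℝ) < Fintype.card ι := by exact_mod_cast Fintype.card_pos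
  obtain ⟨X, hX, hmin⟩ := Finset.exists_min_image
    ((Finset.univ : Finset (Finset ι)).filter fun X => (∀ x y, R.Adj x y → (x ∈ X ↔ y ∈ X)) ∧
      γ * Fintype.card ι ≤ X.card) Finset.card
    ⟨Finset.univ, by simp; nlinarith⟩
  simp only [Finset.mem_filter, Finset.mem_univ, true_and] at hX hmin
  have hcl : ∀ x y z, R.Adj y z → (y ∈ component R x ↔ z ∈ component R x) := fun x y z e => by
    rw [mem_component, mem_component]
    exact ⟨fun h => h.trans e.reachable, fun h => h.trans e.symm.reachable⟩
  by_cases hXc : γ * Fintype.card ι ≤ (Xᶜ).card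
  · exact ⟨X, hX.1, hX.2, hXc⟩
  have h1 := card_add_card_compl_real X
  push Not at hXc
  obtain ⟨x, hx⟩ : X.Nonempty := by
    rw [← Finset.card_pos]
    have : (0 : ℝ) < X.card := by nlinarith
    exact_mod_cast this
  have h2 : ((X \ component R x).card : ℝ) < γ * Fintype.card ι := by
    by_contra! hge
    have h3 := hmin (X \ component R x) ⟨fun y z e => by
      rw [Finset.mem_sdiff, Finset.mem_sdiff, hX.1 y z e, hcl x y z e], hge⟩
    have h4 : X \ component R x ⊂ X := by
      refine Finset.ssubset_iff_of_subset Finset.sdiff_subset |>.2 ⟨x, hx, ?_⟩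
      simp [mem_component]
    exact absurd (Finset.card_lt_card h4) (not_lt.2 h3)
  have h3 := card_le_add_of_forall_mem_or (S := X) (A := X \ component R x) (T := component R x)
    (fun y hy => by rw [Finset.mem_sdiff]; tauto)
  have h4 := card_add_card_compl_real (component R x)
  have h5 := h x
  exact ⟨component R x, hcl x, by nlinarith, by nlinarith⟩

theorem NearlyComplete.expandingPair_or_splitPair [Nonempty ι] (h : NearlyComplete R B g μ) {δ : ℝ}
    (hδ : 40 * μ ≤ δ) (hδ0 : 0 < δ) (hδ1 : δ ≤ 1) :
    HasExpandingPair R B δ ∨ ∃ X Y, SplitPair R B g X Y := by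
  have hμ0 := h.pos_of_nonempty
  by_cases h1 : ∃ x, (1 - δ / 4) * Fintype.card ι ≤ (component R x).card
  · obtain ⟨x, hx⟩ := h1
    exact Or.inl (h.hasExpandingPair_of_large_component (by linarith) (by linarith) x hx)
  by_cases h2 : ∃ x, (1 - δ / 4) * Fintype.card ι ≤ (component B x).card
  · obtain ⟨x, hx⟩ := h2
    exact Or.inl (h.swap.hasExpandingPair_of_large_component (by linarith) (by linarith) x hx).swap
  push Not at h1 h2
  obtain ⟨X, hX, hX1, hX2⟩ := exists_cut (by linarith) h1
  obtain ⟨Y, hY, hY1, hY2⟩ := exists_cut (by linarith) h2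
  exact h.of_cuts (γ := δ / 4) (by linarith) (by linarith) (by linarith) (by linarith)
    hX hY hX1 hY1 hX2 hY2

end LargeComponent

section Matching

open scoped Classical

variable {ι : Type*} [Fintype ι]

/-- Deficiency version of Hall's theorem. -/
lemma exists_injOn_of_card_le_add (t : ι → Finset ι) (d : ℕ)
    (h : ∀ I : Finset ι, I.card ≤ (I.biUnion t).card + d) :
    ∃ (J : Finset ι) (σ : ι → ι), Set.InjOn σ J ∧ (∀ x ∈ J, σ x ∈ t x) ∧
      Fintype.card ι ≤ J.card + d := by
  obtain ⟨f, hf, hft⟩ := (Finset.all_card_le_biUnion_card_iff_exists_injective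
    (fun x => (t x).disjSum (Finset.univ : Finset (Fin d)))).1 (fun I => by
      rcases I.eq_empty_or_nonempty with rfl | ⟨a, ha⟩
      · simp
      · have h1 : (I.biUnion t).disjSum (Finset.univ : Finset (Fin d)) ⊆
            I.biUnion fun x => (t x).disjSum (Finset.univ : Finset (Fin d)) := by
          rintro (y | y) hy
          · simpa using hy
          · simpa using ⟨a, ha⟩
        have h2 := Finset.card_le_card h1
        rw [Finset.card_disjSum, Finset.card_univ, Fintype.card_fin] at h2
        exact (h I).trans h2)
  refine ⟨Finset.univ.filter fun x => (f x).isLeft, fun x => (f x).elim id fun _ => x, ?_, ?_, ?_⟩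
  · intro x hx y hy hxy
    simp only [Finset.coe_filter, Finset.mem_univ, true_and, Set.mem_ofPred_eq,
      Sum.isLeft_iff] at hx hy
    obtain ⟨a, ha⟩ := hx
    obtain ⟨b, hb⟩ := hy
    simp only [ha, hb, Sum.elim_inl, id] at hxy
    exact hf (by rw [ha, hb, hxy])
  · intro x hx
    simp only [Finset.mem_filter, Finset.mem_univ, true_and, Sum.isLeft_iff] at hx
    obtain ⟨a, ha⟩ := hx
    have := hft x
    simpa [ha] using this
  · have h1 := Finset.card_filter_add_card_filter_not (s := Finset.univ)
      (fun x => (f x).isLeft = true)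
    have h2 : (Finset.univ.filter fun x => ¬ (f x).isLeft = true).card ≤ d := by
      have h3 := Finset.card_le_card_of_injOn f
        (s := Finset.univ.filter fun x => ¬ (f x).isLeft = true)
        (t := (Finset.univ : Finset (Fin d)).map Function.Embedding.inr) (fun x hx => by
          simp only [Finset.coe_filter, Finset.mem_univ, true_and, Set.mem_ofPred_eq] at hx
          rcases hfx : f x with a | a
          · simp [hfx] at hx
          · simp) hf.injOn
      simpa using h3
    rw [Finset.card_univ] at h1
    omega

variable {R B : SimpleGraph ι} {C D : Set ι} {δ : ℝ}

lemma IndepExpanding.card_le (h : IndepExpanding R B C D δ) (I : Finset ι) :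
    (I.card : ℝ) ≤ (I.biUnion (unionNbr R B C D)).card + δ * Fintype.card ι := by
  have hmem : ∀ I : Finset ι, ∀ y, y ∈ I.biUnion (unionNbr R B C D) ↔
      ∃ x ∈ I, UnionAdj R B C D x y := by simp [unionNbr]
  set Nb := I.biUnion (unionNbr R B C D) with hNb
  set K := I \ Nb with hK
  have h1 := h K (fun x hx y hy hxy => (Finset.mem_sdiff.1 hy).2
    ((hmem I y).2 ⟨x, (Finset.mem_sdiff.1 hx).1, hxy⟩))
  have h2 : Disjoint (K.biUnion (unionNbr R B C D)) (I ∩ Nb) := by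
    refine Finset.disjoint_left.2 fun y hy hy' => ?_
    obtain ⟨x, hx, hxy⟩ := (hmem K y).1 hy
    refine (Finset.mem_sdiff.1 hx).2 ((hmem I x).2 ⟨y, (Finset.mem_inter.1 hy').1, ?_⟩)
    rcases hxy with e | e
    · exact Or.inl ⟨e.2.1, e.1, e.2.2.symm⟩
    · exact Or.inr ⟨e.2.1, e.1, e.2.2.symm⟩
  have h3 : K.biUnion (unionNbr R B C D) ∪ I ∩ Nb ⊆ Nb :=
    Finset.union_subset (Finset.biUnion_subset_biUnion_of_subset_left _ Finset.sdiff_subset)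
      Finset.inter_subset_right
  have h4 : ((K.biUnion (unionNbr R B C D)).card : ℝ) + (I ∩ Nb).card ≤ Nb.card := by
    exact_mod_cast (Finset.card_union_of_disjoint h2) ▸ Finset.card_le_card h3
  have h5 : (K.card : ℝ) + (I ∩ Nb).card = I.card := by
    exact_mod_cast Finset.card_sdiff_add_card_inter I Nb
  linarith

lemma IndepExpanding.exists_matching (h : IndepExpanding R B C D δ) (hδ : 0 ≤ δ) :
    ∃ (J : Finset ι) (σ : ι → ι), Set.InjOn σ J ∧ (∀ x ∈ J, UnionAdj R B C D x (σ x)) ∧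
      (1 - δ) * Fintype.card ι ≤ J.card := by
  obtain ⟨J, σ, h1, h2, h3⟩ := exists_injOn_of_card_le_add (unionNbr R B C D)
    ⌊δ * Fintype.card ι⌋₊ (fun I => by
      have h1 := h.card_le I
      by_contra! hlt
      have h2 : ⌊δ * Fintype.card ι⌋₊ < I.card - (I.biUnion (unionNbr R B C D)).card := by omega
      have h4 : (I.biUnion (unionNbr R B C D)).card ≤ I.card := by omega
      rw [Nat.floor_lt (by positivity), Nat.cast_sub h4] at h2
      linarith)
  refine ⟨J, σ, h1, fun x hx => by simpa [unionNbr] using h2 x hx, ?_⟩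
  have h4 : (⌊δ * Fintype.card ι⌋₊ : ℝ) ≤ δ * Fintype.card ι := Nat.floor_le (by positivity)
  have h5 : (Fintype.card ι : ℝ) ≤ J.card + ⌊δ * Fintype.card ι⌋₊ := by exact_mod_cast h3
  linarith

end Matching

section LongPaths

open scoped Classical

variable {V : Type*}

/-- Any two subsets of `A` and `B` of size at least `t` have a `Γ`-edge between them. -/
def JoinedAt (Γ : SimpleGraph V) (t : ℕ) (A B : Finset V) : Prop :=
  ∀ A' ⊆ A, ∀ B' ⊆ B, t ≤ A'.card → t ≤ B'.card → ∃ a ∈ A', ∃ b ∈ B', Γ.Adj a b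

variable {Γ : SimpleGraph V} {t : ℕ} {A B L R : Finset V}

lemma JoinedAt.mono (h : JoinedAt Γ t A B) (hL : L ⊆ A) (hR : R ⊆ B) : JoinedAt Γ t L R :=
  fun A' hA' B' hB' => h A' (hA'.trans hL) B' (hB'.trans hR)

/-- Depth-first search: the path `l` and the equally large sets `U` and `T` partition `W`. -/
lemma exists_chain_partition (Γ : SimpleGraph V) (W : Finset V) :
    ∃ (l : List V) (U T : Finset V), l.Nodup ∧ l.IsChain Γ.Adj ∧ U.card = T.card ∧
      Disjoint U T ∧ (∀ x, x ∈ W ↔ x ∈ l ∨ x ∈ U ∨ x ∈ T) ∧ (∀ x ∈ l, x ∉ U ∧ x ∉ T) ∧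
      ∀ u ∈ U, ∀ w ∈ T, ¬ Γ.Adj u w := by
  suffices H : ∀ (m : ℕ) (l : List V) (U T : Finset V), l.Nodup → l.IsChain Γ.Adj →
      U.card = T.card + m → Disjoint U T → (∀ x, x ∈ W ↔ x ∈ l ∨ x ∈ U ∨ x ∈ T) →
      (∀ x ∈ l, x ∉ U ∧ x ∉ T) → (∀ u ∈ U, ∀ w ∈ T, ¬ Γ.Adj u w) →
      ∃ (l : List V) (U T : Finset V), l.Nodup ∧ l.IsChain Γ.Adj ∧ U.card = T.card ∧
      Disjoint U T ∧ (∀ x, x ∈ W ↔ x ∈ l ∨ x ∈ U ∨ x ∈ T) ∧ (∀ x ∈ l, x ∉ U ∧ x ∉ T) ∧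
      ∀ u ∈ U, ∀ w ∈ T, ¬ Γ.Adj u w by
    exact H W.card [] W ∅ (by simp) (by simp) (by simp) (by simp) (by simp) (by simp) (by simp)
  intro m
  induction m with
  | zero =>
    intro l U T h1 h2 h3 h4 h5 h6 h7
    exact ⟨l, U, T, h1, h2, h3, h4, h5, h6, h7⟩
  | succ m ih =>
    intro l U T h1 h2 h3 h4 h5 h6 h7
    have push : ∀ u ∈ U, (u :: l).IsChain Γ.Adj → ∃ (l : List V) (U T : Finset V), l.Nodup ∧
        l.IsChain Γ.Adj ∧ U.card = T.card ∧
        Disjoint U T ∧ (∀ x, x ∈ W ↔ x ∈ l ∨ x ∈ U ∨ x ∈ T) ∧ (∀ x ∈ l, x ∉ U ∧ x ∉ T) ∧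
        ∀ u ∈ U, ∀ w ∈ T, ¬ Γ.Adj u w := by
      intro u hu hl
      have huT : u ∉ T := Finset.disjoint_left.1 h4 hu
      refine ih (u :: l) (U.erase u) T (List.nodup_cons.2 ⟨fun h => (h6 u h).1 hu, h1⟩) hl
        (by rw [Finset.card_erase_of_mem hu]; omega)
        (Finset.disjoint_of_subset_left (Finset.erase_subset _ _) h4) (fun x => ?_) (fun x hx => ?_)
        (fun x hx => h7 x (Finset.mem_of_mem_erase hx))
      · rw [h5, List.mem_cons, Finset.mem_erase]
        by_cases hxu : x = u <;> simp [hxu, hu]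
      · rw [Finset.mem_erase]
        rcases List.mem_cons.1 hx with rfl | hx
        · simp [huT]
        · exact ⟨fun h => (h6 x hx).1 h.2, (h6 x hx).2⟩
    rcases l with _ | ⟨v, l⟩
    · obtain ⟨u, hu⟩ : U.Nonempty := Finset.card_pos.1 (by omega)
      exact push u hu (by simp)
    · by_cases hv : ∃ u ∈ U, Γ.Adj u v
      · obtain ⟨u, hu, huv⟩ := hv
        exact push u hu (by simpa using ⟨huv, h2⟩)
      · push Not at hv
        have hvm := h6 v (by simp)
        have hvl := (List.nodup_cons.1 h1).1
        refine ih l U (insert v T) (List.nodup_cons.1 h1).2 h2.tail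
          (by rw [Finset.card_insert_of_notMem hvm.2]; omega)
          (Finset.disjoint_insert_right.2 ⟨hvm.1, h4⟩) (fun x => ?_) (fun x hx => ?_) ?_
        · rw [h5, List.mem_cons, Finset.mem_insert]; tauto
        · refine ⟨(h6 x (by simp [hx])).1, fun h => ?_⟩
          rcases Finset.mem_insert.1 h with rfl | h
          · exact hvl hx
          · exact (h6 x (by simp [hx])).2 h
        · intro u hu w hw
          rcases Finset.mem_insert.1 hw with rfl | hw
          · exact hv u hu
          · exact h7 u hu w hw

/-- The edges of `Γ` between `L` and `R`. -/
def bipartiteBetween (Γ : SimpleGraph V) (L R : Finset V) : SimpleGraph V where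
  Adj a b := Γ.Adj a b ∧ (a ∈ L ∧ b ∈ R ∨ a ∈ R ∧ b ∈ L)
  symm := ⟨fun a b h => ⟨h.1.symm, by tauto⟩⟩
  loopless := ⟨fun a h => Γ.loopless.irrefl a h.1⟩

lemma card_inter_of_isChain (hLR : Disjoint L R) (a : V) (l : List V) (hn : (a :: l).Nodup)
    (hl : (a :: l).IsChain (bipartiteBetween Γ L R).Adj) :
    (a ∈ L → ((a :: l).toFinset ∩ R).card ≤ ((a :: l).toFinset ∩ L).card ∧
      ((a :: l).toFinset ∩ L).card ≤ ((a :: l).toFinset ∩ R).card + 1) ∧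
    (a ∈ R → ((a :: l).toFinset ∩ L).card ≤ ((a :: l).toFinset ∩ R).card ∧
      ((a :: l).toFinset ∩ R).card ≤ ((a :: l).toFinset ∩ L).card + 1) := by
  induction l generalizing a with
  | nil =>
    constructor <;> intro ha
    · have : a ∉ R := Finset.disjoint_left.1 hLR ha
      simp [ha, this]
    · have : a ∉ L := Finset.disjoint_right.1 hLR ha
      simp [ha, this]
  | cons b l ih =>
    obtain ⟨hab, hl⟩ := List.isChain_cons_cons.1 hl
    obtain ⟨hna, hn⟩ := List.nodup_cons.1 hn
    obtain ⟨ih1, ih2⟩ := ih b hn hl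
    have hna' : a ∉ (b :: l).toFinset := by simpa using hna
    have h1 : ∀ S : Finset V, ((a :: b :: l).toFinset ∩ S).card =
        ((b :: l).toFinset ∩ S).card + if a ∈ S then 1 else 0 := by
      intro S
      rw [List.toFinset_cons (a := a)]
      split_ifs with h
      · rw [Finset.insert_inter_of_mem h, Finset.card_insert_of_notMem (fun h => hna'
          (Finset.mem_inter.1 h).1)]
      · rw [Finset.insert_inter_of_notMem h, add_zero]
    have hd : ∀ x, x ∈ L → x ∉ R := fun x hx => Finset.disjoint_left.1 hLR hx
    constructor <;> intro ha
    · have hb : b ∈ R := by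
        rcases hab.2 with h | h
        · exact h.2
        · exact absurd h.1 (hd a ha)
      have := ih2 hb
      rw [h1, h1, if_pos ha, if_neg (hd a ha)]
      omega
    · have haL : a ∉ L := fun h => hd a h ha
      have hb : b ∈ L := by
        rcases hab.2 with h | h
        · exact absurd h.1 haL
        · exact h.2
      have := ih1 hb
      rw [h1, h1, if_pos ha, if_neg haL]
      omega

lemma card_inter_add_card_inter (hLR : Disjoint L R) {l : List V} (hn : l.Nodup)
    (hl : ∀ x ∈ l, x ∈ L ∨ x ∈ R) :
    (l.toFinset ∩ L).card + (l.toFinset ∩ R).card = l.length := by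
  rw [← List.toFinset_card_of_nodup hn, ← Finset.card_union_of_disjoint
    (Finset.disjoint_of_subset_left Finset.inter_subset_right
      (Finset.disjoint_of_subset_right Finset.inter_subset_right hLR)),
    ← Finset.inter_union_distrib_left, Finset.inter_eq_left.2]
  intro x hx
  simpa using hl x (by simpa using hx)

lemma two_mul_card_inter_of_isChain (hLR : Disjoint L R) {l : List V} (hn : l.Nodup)
    (hl : ∀ x ∈ l, x ∈ L ∨ x ∈ R) (hc : l.IsChain (bipartiteBetween Γ L R).Adj)
    (he : Even l.length) :
    2 * (l.toFinset ∩ L).card = l.length ∧ 2 * (l.toFinset ∩ R).card = l.length := by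
  rcases l with _ | ⟨a, l⟩
  · simp
  · have h1 := card_inter_add_card_inter hLR hn hl
    have h2 := card_inter_of_isChain hLR a l hn hc
    obtain ⟨k, hk⟩ := he
    rcases hl a (by simp) with h | h
    · have := h2.1 h
      omega
    · have := h2.2 h
      omega

/-- Two joined sets of equal size contain a long path, whose two ends meet `L` in many vertices. -/
lemma JoinedAt.exists_path {h : ℕ} (hJ : JoinedAt Γ t L R) (hLR : Disjoint L R) (hL : L.card = h)
    (hR : R.card = h) (ht : 4 * t ≤ h) :
    ∃ Hd M Tl : List V, (Hd ++ M ++ Tl).Nodup ∧ (Hd ++ M ++ Tl).IsChain Γ.Adj ∧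
      (∀ x ∈ Hd ++ M ++ Tl, x ∈ L ∨ x ∈ R) ∧ 2 * h ≤ M.length + 8 * t ∧
      t ≤ (Hd.toFinset ∩ L).card ∧ t ≤ (Tl.toFinset ∩ L).card := by
  obtain ⟨l, U, T, hn, hc, hUT, hd, hW, hl, hno⟩ :=
    exists_chain_partition (bipartiteBetween Γ L R) (L ∪ R)
  have hlW : ∀ x ∈ l, x ∈ L ∨ x ∈ R := fun x hx => Finset.mem_union.1 ((hW x).2 (Or.inl hx))
  have hcard : ∀ S ⊆ L ∪ R, (l.toFinset ∩ S).card + (U ∩ S).card + (T ∩ S).card = S.card := by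
    intro S hS
    rw [← Finset.card_union_of_disjoint, ← Finset.card_union_of_disjoint]
    · congr 1
      ext x
      have := hW x
      have h2 : x ∈ S → x ∈ L ∪ R := fun h => hS h
      simp only [Finset.mem_union, Finset.mem_inter, List.mem_toFinset] at *
      tauto
    · rw [Finset.disjoint_left]
      intro x hx hx'
      simp only [Finset.mem_union, Finset.mem_inter, List.mem_toFinset] at hx hx'
      rcases hx with hx | hx
      · exact (hl x hx.1).2 hx'.1
      · exact Finset.disjoint_left.1 hd hx.1 hx'.1
    · rw [Finset.disjoint_left]
      intro x hx hx'
      simp only [Finset.mem_inter, List.mem_toFinset] at hx hx'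
      exact (hl x hx.1).1 hx'.1
  have hcL := hcard L Finset.subset_union_left
  have hcR := hcard R Finset.subset_union_right
  have hsum := card_inter_add_card_inter hLR hn hlW
  have hsplit : ∀ S ⊆ L ∪ R, (S ∩ L).card + (S ∩ R).card = S.card := by
    intro S hS
    rw [← Finset.card_union_of_disjoint (Finset.disjoint_of_subset_left Finset.inter_subset_right
      (Finset.disjoint_of_subset_right Finset.inter_subset_right hLR)),
      ← Finset.inter_union_distrib_left, Finset.inter_eq_left.2 hS]
  have hU := hsplit U (fun x hx => (hW x).2 (Or.inr (Or.inl hx)))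
  have hT := hsplit T (fun x hx => (hW x).2 (Or.inr (Or.inr hx)))
  have hev : Even l.length := ⟨h - U.card, by omega⟩
  have hbal := two_mul_card_inter_of_isChain hLR hn hlW hc hev
  have hno1 : ¬ (t ≤ (U ∩ L).card ∧ t ≤ (T ∩ R).card) := by
    rintro ⟨h1, h2⟩
    obtain ⟨a, ha, b, hb, hab⟩ := hJ _ Finset.inter_subset_right _ Finset.inter_subset_right h1 h2
    rw [Finset.mem_inter] at ha hb
    exact hno a ha.1 b hb.1 ⟨hab, Or.inl ⟨ha.2, hb.2⟩⟩
  have hno2 : ¬ (t ≤ (T ∩ L).card ∧ t ≤ (U ∩ R).card) := by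
    rintro ⟨h1, h2⟩
    obtain ⟨a, ha, b, hb, hab⟩ := hJ _ Finset.inter_subset_right _ Finset.inter_subset_right h1 h2
    rw [Finset.mem_inter] at ha hb
    exact hno b hb.1 a ha.1 ⟨hab.symm, Or.inr ⟨hb.2, ha.2⟩⟩
  have hlen : 2 * h ≤ l.length + 4 * t := by omega
  set M := (l.drop (2 * t)).take (l.length - 4 * t) with hM
  have hdec : l = l.take (2 * t) ++ M ++ (l.drop (2 * t)).drop (l.length - 4 * t) := by
    rw [List.append_assoc, List.take_append_drop, List.take_append_drop]
  have fat : ∀ l' : List V, l' <:+: l → l'.length = 2 * t → t ≤ (l'.toFinset ∩ L).card := by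
    intro l' h1 h2
    have := two_mul_card_inter_of_isChain hLR (h1.sublist.nodup hn)
      (fun x hx => hlW x (h1.subset hx)) (hc.infix h1) (by rw [h2]; exact even_two_mul t)
    omega
  refine ⟨l.take (2 * t), M, (l.drop (2 * t)).drop (l.length - 4 * t), ?_, ?_, ?_, ?_, ?_, ?_⟩
  · rwa [← hdec]
  · rw [← hdec]
    exact hc.imp fun a b h => h.1
  · rwa [← hdec]
  · rw [hM, List.length_take, List.length_drop]
    omega
  · exact fat _ (List.take_prefix _ _).isInfix (by rw [List.length_take]; omega)
  · refine fat _ ((List.drop_suffix _ _).isInfix.trans (List.drop_suffix _ _).isInfix) ?_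
    rw [List.length_drop, List.length_drop]; omega

end LongPaths

section Assembly

open scoped Classical

variable {V ι : Type*} {Γ : SimpleGraph V} {t : ℕ}

/-- Following a walk of the reduced graph, one can connect two large sets through the unused part
of the reservoir `Z`. -/
lemma exists_link {H : SimpleGraph ι} {A Z : ι → Finset V}
    (hd : ∀ x y, x ≠ y → Disjoint (A x) (A y)) (hA : ∀ x y, H.Adj x y → JoinedAt Γ t (A x) (A y))
    (hZ : ∀ z, Z z ⊆ A z) {U : Finset V} (hU : ∀ z, 2 * t ≤ (Z z \ U).card) {x y : ι}
    (w : H.Walk x y) : ¬ w.Nil → w.support.tail.Nodup → ∀ S ⊆ A x, ∀ T ⊆ A y,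
      t ≤ S.card → t ≤ T.card → ∃ a ∈ S, ∃ b ∈ T, ∃ p : List V, (a :: p ++ [b]).IsChain Γ.Adj ∧
        p.Nodup ∧ p.length ≤ w.length ∧ ∀ v ∈ p, v ∉ U ∧ ∃ z ∈ w.support.tail, v ∈ Z z := by
  induction w with
  | nil => intro h; simp at h
  | @cons x x₁ y h w ih =>
    intro _ hn S hS T hT hSt hTt
    rw [Walk.support_cons, List.tail_cons] at hn
    by_cases hw : w.Nil
    · obtain rfl := hw.eq
      obtain ⟨a, ha, b, hb, hab⟩ := hA _ _ h S hS T hT hSt hTt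
      exact ⟨a, ha, b, hb, [], by simpa using hab, by simp, by simp, by simp⟩
    · set S' := (Z x₁ \ U).filter fun v => ∃ a ∈ S, Γ.Adj a v with hS'
      have hcard : t ≤ S'.card := by
        by_contra! hlt
        have h1 := Finset.card_filter_add_card_filter_not (s := Z x₁ \ U)
          (fun v => ∃ a ∈ S, Γ.Adj a v)
        have h2 := hU x₁
        rw [← hS'] at h1
        obtain ⟨a, ha, b, hb, hab⟩ := hA _ _ h S hS
          ((Z x₁ \ U).filter fun v => ¬ ∃ a ∈ S, Γ.Adj a v)
          ((Finset.filter_subset _ _).trans (Finset.sdiff_subset.trans (hZ _))) hSt (by omega)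
        exact (Finset.mem_filter.1 hb).2 ⟨a, ha, hab⟩
      rw [← Walk.cons_tail_support] at hn
      obtain ⟨hx₁, hn'⟩ := List.nodup_cons.1 hn
      obtain ⟨a', ha', b, hb, p, hp, hpn, hpl, hpz⟩ := ih hw hn' S'
        ((Finset.filter_subset _ _).trans (Finset.sdiff_subset.trans (hZ _))) T hT hcard hTt
      obtain ⟨ha1, a, ha, haa'⟩ := Finset.mem_filter.1 ha'
      obtain ⟨ha1, ha2⟩ := Finset.mem_sdiff.1 ha1
      refine ⟨a, ha, b, hb, a' :: p, List.isChain_cons_cons.2 ⟨haa', hp⟩,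
        List.nodup_cons.2 ⟨fun hap => ?_, hpn⟩, by simpa using hpl, fun v hv => ?_⟩
      · obtain ⟨-, z, hz, hz'⟩ := hpz a' hap
        refine Finset.disjoint_left.1 (hd x₁ z ?_) (hZ _ ha1) (hZ _ hz')
        rintro rfl
        exact hx₁ hz
      · rcases List.mem_cons.1 hv with rfl | hv
        · exact ⟨ha2, x₁, by simp, ha1⟩
        · obtain ⟨h1, z, hz, hz'⟩ := hpz v hv
          exact ⟨h1, z, by simpa using List.mem_of_mem_tail hz, hz'⟩

/-- Any two sets of size `t` inside `A` and `A'` can be connected by a short path through `Z`,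
which avoids a given set of at most `m` vertices. -/
def Linked (Γ : SimpleGraph V) (t n m : ℕ) (Z A A' : Finset V) : Prop :=
  ∀ U : Finset V, U.card ≤ m → ∀ S ⊆ A, ∀ T ⊆ A', t ≤ S.card → t ≤ T.card →
    ∃ a ∈ S, ∃ b ∈ T, ∃ p : List V, (a :: p ++ [b]).IsChain Γ.Adj ∧ p.Nodup ∧ p.length ≤ n ∧
      ∀ v ∈ p, v ∈ Z ∧ v ∉ U

lemma linked_of_reachable [Fintype ι] {H : SimpleGraph ι} {A Z : ι → Finset V}
    (hd : ∀ x y, x ≠ y → Disjoint (A x) (A y)) (hA : ∀ x y, H.Adj x y → JoinedAt Γ t (A x) (A y))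
    (hZ : ∀ z, Z z ⊆ A z) {m : ℕ} (hm : ∀ z, 2 * t + m ≤ (Z z).card) {x y : ι}
    (h : H.Reachable x y) (hx : ∃ z, H.Adj x z) :
    Linked Γ t (Fintype.card ι) m (Finset.univ.biUnion Z) (A x) (A y) := by
  obtain ⟨w, hw, hwn⟩ : ∃ w : H.Walk x y, ¬ w.Nil ∧ w.support.tail.Nodup := by
    by_cases hxy : x = y
    · subst hxy
      obtain ⟨z, hz⟩ := hx
      refine ⟨Walk.cons hz (Walk.cons hz.symm Walk.nil), by simp, ?_⟩
      simpa using hz.ne'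
    · obtain ⟨w, hw⟩ := h.exists_isPath
      refine ⟨w, fun h => hxy h.eq, hw.support_nodup.sublist (List.tail_sublist _)⟩
  have hlen : w.length ≤ Fintype.card ι := by
    have := hwn.length_le_card
    rwa [List.length_tail, Walk.length_support, Nat.add_sub_cancel] at this
  intro U hU S hS T hT hSt hTt
  obtain ⟨a, ha, b, hb, p, h1, h2, h3, h4⟩ := exists_link hd hA hZ (U := U) (fun z => by
    have := Finset.le_card_sdiff U (Z z)
    have := hm z
    omega) w hw hwn S hS T hT hSt hTt
  refine ⟨a, ha, b, hb, p, h1, h2, h3.trans hlen, fun v hv => ?_⟩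
  obtain ⟨h5, z, -, hz⟩ := h4 v hv
  exact ⟨by simpa using ⟨z, hz⟩, h5⟩

/-- The list `Hd ++ M ++ Tl` is a path, and its ends contain many vertices of `A` and `A'`. -/
structure FatPath (Γ : SimpleGraph V) (t : ℕ) (A A' : Finset V) (Hd M Tl : List V) : Prop where
  nodup : (Hd ++ M ++ Tl).Nodup
  chain : (Hd ++ M ++ Tl).IsChain Γ.Adj
  le_head : t ≤ (Hd.toFinset ∩ A).card
  le_tail : t ≤ (Tl.toFinset ∩ A').card

lemma FatPath.merge {n m : ℕ} {Z A₁ A₂ A₃ A₄ : Finset V} {Hd M Tl Hd' M' Tl' : List V}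
    (h : FatPath Γ t A₁ A₂ Hd M Tl) (h' : FatPath Γ t A₃ A₄ Hd' M' Tl')
    (hd : (Hd ++ M ++ Tl).Disjoint (Hd' ++ M' ++ Tl'))
    (hm : ((Hd ++ M ++ Tl ++ (Hd' ++ M' ++ Tl')).toFinset ∩ Z).card ≤ m)
    (hl : Linked Γ t n m Z A₂ A₃) :
    ∃ N p : List V, FatPath Γ t A₁ A₄ Hd N Tl' ∧ p.length ≤ n ∧ (∀ v ∈ p, v ∈ Z) ∧
      (∀ v, v ∈ M ∨ v ∈ M' → v ∈ N) ∧
      ∀ v ∈ Hd ++ N ++ Tl', v ∈ Hd ++ M ++ Tl ∨ v ∈ Hd' ++ M' ++ Tl' ∨ v ∈ p := by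
  obtain ⟨a, ha, b, hb, p, hp, hpn, hpl, hpZ⟩ := hl _ hm _ Finset.inter_subset_right _
    Finset.inter_subset_right h.le_tail h'.le_head
  obtain ⟨T₁, T₂, rfl⟩ := List.append_of_mem (List.mem_toFinset.1 (Finset.mem_inter.1 ha).1)
  obtain ⟨D₁, D₂, rfl⟩ := List.append_of_mem (List.mem_toFinset.1 (Finset.mem_inter.1 hb).1)
  have hpre : (Hd ++ M ++ T₁ ++ [a]) <+: (Hd ++ M ++ (T₁ ++ a :: T₂)) := ⟨T₂, by simp⟩
  have hsuf : (b :: D₂ ++ M' ++ Tl') <:+ ((D₁ ++ b :: D₂) ++ M' ++ Tl') := ⟨D₁, by simp⟩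
  have hc1 := h.chain.prefix hpre
  have hc2 := h'.chain.suffix hsuf
  have hn1 := hpre.sublist.nodup h.nodup
  have hn2 := hsuf.sublist.nodup h'.nodup
  have hpU : ∀ v ∈ p, v ∉ Hd ++ M ++ (T₁ ++ a :: T₂) ∧ v ∉ D₁ ++ b :: D₂ ++ M' ++ Tl' := by
    intro v hv
    obtain ⟨h1, h2⟩ := hpZ v hv
    rw [Finset.mem_inter, List.mem_toFinset, List.mem_append] at h2
    tauto
  have heq : Hd ++ (M ++ T₁ ++ [a] ++ p ++ (b :: D₂ ++ M')) ++ Tl' =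
      (Hd ++ M ++ T₁ ++ [a]) ++ p ++ (b :: D₂ ++ M' ++ Tl') := by simp
  refine ⟨M ++ T₁ ++ [a] ++ p ++ (b :: D₂ ++ M'), p, ⟨?_, ?_, h.le_head, h'.le_tail⟩, hpl,
    fun v hv => (hpZ v hv).1, fun v hv => ?_, fun v hv => ?_⟩
  · rw [heq]
    refine List.Nodup.append (List.Nodup.append hn1 hpn fun v hv hv' => ?_) hn2 fun v hv hv' => ?_
    · exact (hpU v hv').1 (hpre.subset hv)
    · rcases List.mem_append.1 hv with hv | hv
      · exact hd (hpre.subset hv) (hsuf.subset hv')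
      · exact (hpU v hv).2 (hsuf.subset hv')
  · rw [heq]
    have h1 : (Hd ++ M ++ T₁ ++ [a] ++ (p ++ [b])).IsChain Γ.Adj :=
      hc1.append_overlap (by simpa using hp) (by simp)
    have h2 : ((Hd ++ M ++ T₁ ++ [a] ++ p) ++ [b] ++ (D₂ ++ M' ++ Tl')).IsChain Γ.Adj :=
      List.IsChain.append_overlap (by simpa using h1) (by simpa using hc2) (by simp)
    simpa using h2
  · rcases hv with hv | hv <;> simp [hv]
  · rw [heq, List.mem_append, List.mem_append] at hv
    rcases hv with (hv | hv) | hv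
    · exact Or.inl (hpre.subset hv)
    · exact Or.inr (Or.inr hv)
    · exact Or.inr (Or.inl (hsuf.subset hv))

/-- A path whose ends are adjacent closes up to a cycle. -/
lemma exists_isCycle_of_isChain {u : V} {l : List V} (hn : (u :: l).Nodup)
    (hc : (u :: l).IsChain Γ.Adj) (hl : 2 ≤ l.length)
    (hlast : ∀ v ∈ (u :: l).getLast?, Γ.Adj v u) :
    ∃ (v : V) (p : Γ.Walk v v), p.IsCycle ∧ ∀ x, x ∈ p.support ↔ x ∈ u :: l := by
  have hne : u :: l ≠ [] := List.cons_ne_nil _ _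
  obtain ⟨x, hx⟩ : ∃ x, (u :: l).getLast hne = x := ⟨_, rfl⟩
  have hxu : Γ.Adj x u := hlast x (by rw [List.getLast?_eq_getLast_of_ne_nil hne, hx]; rfl)
  obtain ⟨q, hq⟩ : ∃ q : Γ.Walk u x, q.support = u :: l := by
    subst hx
    exact ⟨Walk.ofSupport (u :: l) hne hc, Walk.support_ofSupport hne hc⟩
  have hqp : q.IsPath := by rw [Walk.isPath_def, hq]; exact hn
  refine ⟨x, Walk.cons hxu q, (Walk.cons_isCycle_iff q hxu).2 ⟨hqp, fun he => ?_⟩, fun y => ?_⟩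
  · have hlen : q.length = l.length := by
      have := q.length_support
      rw [hq, List.length_cons] at this
      omega
    cases q with
    | nil => simp at hlen; omega
    | cons h q =>
      rw [Walk.cons_isPath_iff] at hqp
      rw [Walk.edges_cons, List.mem_cons] at he
      rcases he with he | he
      · rw [Sym2.eq_swap, Sym2.congr_right] at he
        subst he
        have := hqp.1
        rw [Walk.isPath_iff_nil] at this
        rw [Walk.length_cons, Walk.length_eq_zero_iff.2 this] at hlen
        omega
      · exact hqp.2 (q.snd_mem_support_of_mem_edges he)
  · rw [Walk.support_cons, hq, List.mem_cons]
    refine ⟨fun h => ?_, Or.inr⟩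
    rcases h with rfl | h
    · rw [← hx]; exact List.getLast_mem hne
    · exact h

lemma FatPath.exists_isCycle {n m : ℕ} {Z A A' : Finset V} {Hd M Tl : List V}
    (h : FatPath Γ t A A' Hd M Tl) (hM : M ≠ [])
    (hm : ((Hd ++ M ++ Tl).toFinset ∩ Z).card ≤ m) (hl : Linked Γ t n m Z A' A) :
    ∃ (v : V) (p : Γ.Walk v v), p.IsCycle ∧ (∀ x ∈ M, x ∈ p.support) ∧
      ∀ x ∈ p.support, x ∈ Hd ++ M ++ Tl ∨ x ∈ Z := by
  obtain ⟨a, ha, b, hb, p, hp, hpn, -, hpZ⟩ := hl _ hm _ Finset.inter_subset_right _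
    Finset.inter_subset_right h.le_tail h.le_head
  obtain ⟨T₁, T₂, rfl⟩ := List.append_of_mem (List.mem_toFinset.1 (Finset.mem_inter.1 ha).1)
  obtain ⟨D₁, D₂, rfl⟩ := List.append_of_mem (List.mem_toFinset.1 (Finset.mem_inter.1 hb).1)
  have hinf : (b :: D₂ ++ M ++ T₁ ++ [a]) <:+: (D₁ ++ b :: D₂ ++ M ++ (T₁ ++ a :: T₂)) :=
    ⟨D₁, T₂, by simp⟩
  have hc := h.chain.infix hinf
  have hn := hinf.sublist.nodup h.nodup
  have hpU : ∀ v ∈ p, v ∉ D₁ ++ b :: D₂ ++ M ++ (T₁ ++ a :: T₂) := by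
    intro v hv
    obtain ⟨h1, h2⟩ := hpZ v hv
    rw [Finset.mem_inter, List.mem_toFinset] at h2
    tauto
  have h1 : (b :: D₂ ++ M ++ T₁ ++ [a] ++ (p ++ [b])).IsChain Γ.Adj :=
    hc.append_overlap (by simpa using hp) (by simp)
  rw [← List.append_assoc, List.isChain_append] at h1
  have hn' : (b :: D₂ ++ M ++ T₁ ++ [a] ++ p).Nodup :=
    List.Nodup.append hn hpn fun v hv hv' => hpU v hv' (hinf.subset hv)
  have hMl : 1 ≤ M.length := List.length_pos_iff.2 hM
  obtain ⟨v, q, hq, hqs⟩ := exists_isCycle_of_isChain (Γ := Γ) (u := b)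
    (l := D₂ ++ M ++ T₁ ++ [a] ++ p) (by simpa using hn') (by simpa using h1.1)
    (by simp; omega) (fun v hv => h1.2.2 v (by simpa using hv) b (by simp))
  refine ⟨v, q, hq, fun x hx => (hqs x).2 (by simp [hx]), fun x hx => ?_⟩
  have hx' : x ∈ b :: D₂ ++ M ++ T₁ ++ [a] ++ p := by simpa using (hqs x).1 hx
  rcases List.mem_append.1 hx' with hx' | hx'
  · exact Or.inl (hinf.subset hx')
  · exact Or.inr (hpZ x hx').1

/-- Disjoint paths with pairwise linked ends lie, up to their ends, on a common cycle. -/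
theorem exists_isCycle_of_linked {K : Finset ι} (hK : K.Nonempty) {A : ι → Finset V}
    {Hd M Tl : ι → List V} {Z : Finset V} {n : ℕ}
    (hP : ∀ x ∈ K, FatPath Γ t (A x) (A x) (Hd x) (M x) (Tl x))
    (hPd : ∀ x ∈ K, ∀ y ∈ K, x ≠ y → (Hd x ++ M x ++ Tl x).Disjoint (Hd y ++ M y ++ Tl y))
    (hPZ : ∀ x ∈ K, ∀ v ∈ Hd x ++ M x ++ Tl x, v ∉ Z) (hM : ∀ x ∈ K, M x ≠ [])
    (hl : ∀ x ∈ K, ∀ y ∈ K, Linked Γ t n (n * K.card) Z (A x) (A y)) :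
    ∃ (v : V) (p : Γ.Walk v v), p.IsCycle ∧ (∀ x ∈ K, ∀ v ∈ M x, v ∈ p.support) ∧
      ∀ v ∈ p.support, v ∈ Z ∨ ∃ x ∈ K, v ∈ Hd x ++ M x ++ Tl x := by
  have key : ∀ K' : Finset ι, K'.Nonempty → K' ⊆ K → ∃ x ∈ K', ∃ y ∈ K', ∃ N : List V,
      FatPath Γ t (A x) (A y) (Hd x) N (Tl y) ∧ (∀ z ∈ K', ∀ v ∈ M z, v ∈ N) ∧
      (∀ v ∈ Hd x ++ N ++ Tl y, v ∈ Z ∨ ∃ z ∈ K', v ∈ Hd z ++ M z ++ Tl z) ∧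
      ((Hd x ++ N ++ Tl y).toFinset ∩ Z).card ≤ n * K'.card := by
    have hZ0 : ∀ x ∈ K, (Hd x ++ M x ++ Tl x).toFinset ∩ Z = ∅ := by
      intro x hx
      ext v
      simp only [Finset.mem_inter, List.mem_toFinset, Finset.notMem_empty, iff_false, not_and]
      exact hPZ x hx v
    intro K' hK'
    induction hK' using Finset.Nonempty.cons_induction with
    | singleton x =>
      intro hx
      rw [Finset.singleton_subset_iff] at hx
      refine ⟨x, by simp, x, by simp, M x, hP x hx, by simp, fun v hv => ?_, ?_⟩
      · exact Or.inr ⟨x, by simp, hv⟩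
      · rw [hZ0 x hx]; simp
    | cons z K' hz hK' ih =>
      intro hsub
      rw [Finset.cons_eq_insert, Finset.insert_subset_iff] at hsub
      obtain ⟨x, hx, y, hy, N, h1, h2, h3, h4⟩ := ih hsub.2
      obtain ⟨N', p, h5, h6, h7, h8, h9⟩ := (hP z hsub.1).merge h1 (fun v hv hv' => by
          rcases h3 v hv' with h | ⟨w, hw, hw'⟩
          · exact hPZ z hsub.1 v hv h
          · exact hPd z hsub.1 w (hsub.2 hw) (fun h => hz (h ▸ hw)) hv hw') (by
        rw [List.toFinset_append, Finset.union_inter_distrib_right, hZ0 z hsub.1,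
          Finset.empty_union]
        exact h4.trans (Nat.mul_le_mul_left _ (Finset.card_le_card hsub.2)))
        (hl z hsub.1 x (hsub.2 hx))
      refine ⟨z, by simp, y, by simp [hy], N', h5, fun w hw v hv => ?_, fun v hv => ?_, ?_⟩
      · rcases Finset.mem_cons.1 hw with rfl | hw
        · exact h8 v (Or.inl hv)
        · exact h8 v (Or.inr (h2 w hw v hv))
      · rcases h9 v hv with h | h | h
        · exact Or.inr ⟨z, by simp, h⟩
        · rcases h3 v h with h | ⟨w, hw, hw'⟩
          · exact Or.inl h
          · exact Or.inr ⟨w, by simp [hw], hw'⟩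
        · exact Or.inl (h7 v h)
      · have h10 : (Hd z ++ N' ++ Tl y).toFinset ∩ Z ⊆
            ((Hd x ++ N ++ Tl y).toFinset ∩ Z) ∪ p.toFinset := by
          intro v hv
          rw [Finset.mem_inter, List.mem_toFinset] at hv
          rw [Finset.mem_union, Finset.mem_inter, List.mem_toFinset, List.mem_toFinset]
          rcases h9 v hv.1 with h | h | h
          · exact absurd hv.2 (hPZ z hsub.1 v h)
          · exact Or.inl ⟨h, hv.2⟩
          · exact Or.inr h
        have h11 := (Finset.card_le_card h10).trans (Finset.card_union_le _ _)
        have h12 := p.toFinset_card_le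
        rw [Finset.card_cons, mul_add, mul_one]
        omega
  obtain ⟨x, hx, y, hy, N, h1, h2, h3, h4⟩ := key K hK subset_rfl
  obtain ⟨v, p, hp, hp1, hp2⟩ := h1.exists_isCycle (fun h => hM x hx
    (List.eq_nil_iff_forall_not_mem.2 fun v hv => by simpa [h] using h2 x hx v hv)) h4
    (hl y hy x hx)
  refine ⟨v, p, hp, fun z hz w hw => hp1 w (h2 z hz w hw), fun w hw => ?_⟩
  rcases hp2 w hw with h | h
  · exact h3 w h
  · exact Or.inl h

end Assembly

section Cycles

open scoped Classical

variable {V ι : Type*} {G : SimpleGraph V} {c : Sym2 V → Bool} {b : Bool}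

lemma monoSubgraph_adj {u v : V} :
    (monoSubgraph G c b).Adj u v ↔ G.Adj u v ∧ c s(u, v) = b := by
  simp only [monoSubgraph, fromEdgeSet_adj, Set.mem_ofPred_eq, mem_edgeSet]
  exact ⟨fun h => h.1, fun h => ⟨h, h.1.ne⟩⟩

lemma isMonoCycleSet_of_isCycle {v : V} {p : (monoSubgraph G c b).Walk v v} (hp : p.IsCycle) :
    IsMonoCycleSet G c b {x | x ∈ p.support} := by
  have h : ∀ e ∈ p.edges, e ∈ G.edgeSet ∧ c e = b := by
    intro e he
    have := p.edges_subset_edgeSet he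
    induction e with
    | _ x y => exact monoSubgraph_adj.1 this
  refine Or.inr (Or.inr (Or.inr ⟨v, p.transfer G fun e he => (h e he).1, hp.transfer _, ?_, ?_⟩))
  · rw [Walk.edges_transfer]
    exact fun e he => (h e he).2
  · rw [Walk.support_transfer]

lemma exists_disjoint_subsets {A : Finset V} {h m : ℕ} (hA : 2 * h + 2 * m ≤ A.card) :
    ∃ P : Fin 4 → Finset V, (∀ i, P i ⊆ A) ∧ (∀ i j v, v ∈ P i → v ∈ P j → i = j) ∧
      (P 0).card = h ∧ (P 1).card = h ∧ (P 2).card = m ∧ (P 3).card = m := by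
  obtain ⟨L, hL, hLc⟩ := Finset.exists_subset_card_eq (s := A) (n := h) (by omega)
  have h1 := Finset.card_sdiff_of_subset hL
  obtain ⟨R, hR, hRc⟩ := Finset.exists_subset_card_eq (s := A \ L) (n := h) (by omega)
  have h2 := Finset.card_sdiff_of_subset hR
  obtain ⟨Z, hZ, hZc⟩ := Finset.exists_subset_card_eq (s := (A \ L) \ R) (n := m) (by omega)
  have h3 := Finset.card_sdiff_of_subset hZ
  obtain ⟨W, hW, hWc⟩ := Finset.exists_subset_card_eq (s := ((A \ L) \ R) \ Z) (n := m) (by omega)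
  refine ⟨![L, R, Z, W], ?_, ?_, hLc, hRc, hZc, hWc⟩
  · intro i v hv
    fin_cases i
    · exact hL hv
    · have := hR hv
      simp_all
    · have := hZ hv
      simp_all
    · have := hW hv
      simp_all
  · intro i j v hi hj
    have h4 : v ∈ R → v ∉ L := fun h => (Finset.mem_sdiff.1 (hR h)).2
    have h5 : v ∈ Z → v ∉ L ∧ v ∉ R := fun h => by
      have := hZ h
      simp_all
    have h6 : v ∈ W → v ∉ L ∧ v ∉ R ∧ v ∉ Z := fun h => by
      have := hW h
      simp_all
    fin_cases i <;> fin_cases j <;> simp_all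

variable [Fintype ι] {A : ι → Finset V} {P : ι → Fin 4 → Finset V} {t h : ℕ}

/-- The cycle of colour `b` obtained from the part `K` of a matching in the reduced graph `H`, where
the part `i` of the partitions `P` serves as a reservoir. -/
lemma exists_isMonoCycleSet {H : SimpleGraph ι}
    (hPA : ∀ x i, P x i ⊆ A x) (hP : ∀ x i y j v, v ∈ P x i → v ∈ P y j → x = y ∧ i = j)
    (hd : ∀ x y, x ≠ y → Disjoint (A x) (A y))
    (hA : ∀ x y, H.Adj x y → JoinedAt (monoSubgraph G c b) t (A x) (A y))
    (h0 : ∀ x, (P x 0).card = h) (h1 : ∀ x, (P x 1).card = h) {i : Fin 4} (hi0 : i ≠ 0)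
    (hi1 : i ≠ 1) (hi : ∀ x, (P x i).card = 3 * t) (ht : Fintype.card ι ^ 2 ≤ t)
    (hth : 4 * t < h) {K : Finset ι} {σ : ι → ι} (hσ : Set.InjOn σ K)
    (hK : ∀ x ∈ K, H.Adj x (σ x)) (hr : ∀ x ∈ K, ∀ y ∈ K, H.Reachable x y) :
    ∃ S : Finset V, IsMonoCycleSet G c b S ∧ K.card * (2 * h - 8 * t) ≤ S.card ∧
      ∀ v ∈ S, (∃ x, v ∈ P x i) ∨ ∃ x ∈ K, v ∈ P x 0 ∨ v ∈ P (σ x) 1 := by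
  rcases K.eq_empty_or_nonempty with rfl | hKne
  · exact ⟨∅, Or.inl (by simp), by simp, by simp⟩
  have hdis : ∀ x y i j, x ≠ y ∨ i ≠ j → Disjoint (P x i) (P y j) := by
    intro x y i j hne
    refine Finset.disjoint_left.2 fun v hv hv' => ?_
    have := hP _ _ _ _ _ hv hv'
    tauto
  have hpath : ∀ x, ∃ Hd M Tl : List V, x ∈ K →
      FatPath (monoSubgraph G c b) t (A x) (A x) Hd M Tl ∧ 2 * h ≤ M.length + 8 * t ∧
      ∀ v ∈ Hd ++ M ++ Tl, v ∈ P x 0 ∨ v ∈ P (σ x) 1 := by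
    intro x
    by_cases hx : x ∈ K
    · obtain ⟨Hd, M, Tl, e1, e2, e3, e4, e5, e6⟩ := JoinedAt.exists_path
        ((hA _ _ (hK x hx)).mono (hPA x 0) (hPA (σ x) 1)) (hdis x (σ x) 0 1 (Or.inr (by decide)))
        (h0 x) (h1 _) hth.le
      exact ⟨Hd, M, Tl, fun _ => ⟨⟨e1, e2,
        e5.trans (Finset.card_le_card (Finset.inter_subset_inter_left (hPA x 0))),
        e6.trans (Finset.card_le_card (Finset.inter_subset_inter_left (hPA x 0)))⟩, e4, e3⟩⟩
    · exact ⟨[], [], [], fun h => absurd h hx⟩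
  choose Hd M Tl hF using hpath
  have hdisj : ∀ x ∈ K, ∀ y ∈ K, x ≠ y →
      (Hd x ++ M x ++ Tl x).Disjoint (Hd y ++ M y ++ Tl y) := by
    intro x hx y hy hxy v hv hv'
    rcases (hF x hx).2.2 v hv with e1 | e1 <;> rcases (hF y hy).2.2 v hv' with e2 | e2 <;>
      obtain ⟨e3, e4⟩ := hP _ _ _ _ _ e1 e2
    · exact hxy e3
    · exact absurd e4 (by decide)
    · exact absurd e4 (by decide)
    · exact hxy (hσ hx hy e3)
  obtain ⟨v, p, hp, hp1, hp2⟩ := exists_isCycle_of_linked hKne (Γ := monoSubgraph G c b)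
    (n := Fintype.card ι) (Z := Finset.univ.biUnion fun x => P x i) (fun x hx => (hF x hx).1)
    hdisj (fun x hx v hv hvZ => by
      obtain ⟨z, -, hz⟩ := Finset.mem_biUnion.1 hvZ
      rcases (hF x hx).2.2 v hv with e1 | e1 <;> obtain ⟨e3, e4⟩ := hP _ _ _ _ _ hz e1
      · exact hi0 e4
      · exact hi1 e4) (fun x hx hM => by
      have := (hF x hx).2.1
      rw [hM, List.length_nil] at this
      omega) (fun x hx y hy => linked_of_reachable hd hA (fun z => hPA z i) (fun z => by
        have : Fintype.card ι * K.card ≤ Fintype.card ι ^ 2 := by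
          rw [pow_two]; exact Nat.mul_le_mul_left _ (Finset.card_le_univ _)
        rw [hi]; omega) (hr x hx y hy) ⟨_, hK x hx⟩)
  refine ⟨p.support.toFinset, ?_, ?_, fun w hw => ?_⟩
  · convert isMonoCycleSet_of_isCycle hp
    ext; simp
  · have hsub : (K.biUnion fun x => (M x).toFinset) ⊆ p.support.toFinset := by
      intro w hw
      obtain ⟨x, hx, hw⟩ := Finset.mem_biUnion.1 hw
      exact List.mem_toFinset.2 (hp1 x hx w (List.mem_toFinset.1 hw))
    refine le_trans ?_ (Finset.card_le_card hsub)
    rw [Finset.card_biUnion]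
    · rw [← smul_eq_mul]
      refine Finset.card_nsmul_le_sum _ _ _ fun x hx => ?_
      have e1 := (hF x hx).1.nodup
      rw [List.toFinset_card_of_nodup (e1.sublist (by simp))]
      have := (hF x hx).2.1
      omega
    · intro x hx y hy hxy
      refine Finset.disjoint_left.2 fun w hw hw' => hdisj x hx y hy hxy (a := w) ?_ ?_
      · simp [List.mem_toFinset.1 hw]
      · simp [List.mem_toFinset.1 hw']
  · rcases hp2 w (List.mem_toFinset.1 hw) with e | ⟨x, hx, hw⟩
    · exact Or.inl (by simpa using e)
    · exact Or.inr ⟨x, hx, (hF x hx).2.2 w hw⟩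

theorem exists_cycles_of_hasExpandingPair {R B : SimpleGraph ι} {s : ℕ} {δ : ℝ}
    (hd : ∀ x y, x ≠ y → Disjoint (A x) (A y)) (hs : ∀ x, (A x).card = s)
    (hR : ∀ x y, R.Adj x y → JoinedAt (monoSubgraph G c true) t (A x) (A y))
    (hB : ∀ x y, B.Adj x y → JoinedAt (monoSubgraph G c false) t (A x) (A y))
    (hexp : HasExpandingPair R B δ) (hδ : 0 ≤ δ) (ht : Fintype.card ι ^ 2 ≤ t) (ht1 : 1 ≤ t)
    (hts : 20 * t ≤ s) :
    ∃ S T : Finset V, IsMonoCycleSet G c true S ∧ IsMonoCycleSet G c false T ∧ Disjoint S T ∧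
      (1 - δ) * Fintype.card ι * (s - 15 * t) ≤ (S.card : ℝ) + T.card := by
  obtain ⟨C, D, hC, hD, hexp⟩ := hexp
  obtain ⟨J, σ, hσ, hJ, hJc⟩ := hexp.exists_matching hδ
  have hpart : ∀ x, ∃ Q : Fin 4 → Finset V, (∀ i, Q i ⊆ A x) ∧
      (∀ i j v, v ∈ Q i → v ∈ Q j → i = j) ∧ (Q 0).card = (s - 6 * t) / 2 ∧
      (Q 1).card = (s - 6 * t) / 2 ∧ (Q 2).card = 3 * t ∧ (Q 3).card = 3 * t := fun x =>
    exists_disjoint_subsets (by rw [hs]; omega)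
  choose P hPA hP h0 h1 h2 h3 using hpart
  have hP' : ∀ x i y j v, v ∈ P x i → v ∈ P y j → x = y ∧ i = j := by
    intro x i y j v hv hv'
    have hxy : x = y := by
      by_contra hxy
      exact Finset.disjoint_left.1 (hd x y hxy) (hPA _ _ hv) (hPA _ _ hv')
    subst hxy
    exact ⟨rfl, hP x i j v hv hv'⟩
  set p : ι → Prop := fun x => x ∈ C ∧ σ x ∈ C ∧ R.Adj x (σ x) with hp
  have hJB : ∀ x ∈ J.filter fun x => ¬ p x, x ∈ D ∧ σ x ∈ D ∧ B.Adj x (σ x) := by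
    intro x hx
    obtain ⟨hx, hx'⟩ := Finset.mem_filter.1 hx
    exact (hJ x hx).resolve_left hx'
  have hJR : ∀ x ∈ J.filter p, x ∈ C ∧ σ x ∈ C ∧ R.Adj x (σ x) := fun x hx =>
    (Finset.mem_filter.1 hx).2
  obtain ⟨S, hS, hSc, hSm⟩ := exists_isMonoCycleSet (i := 2) (σ := σ) (K := J.filter p)
    hPA hP' hd hR h0 h1 (by decide) (by decide) h2 ht (by omega)
    (hσ.mono (Finset.coe_subset.2 (Finset.filter_subset _ _))) (fun x hx => (hJR x hx).2.2)
    (fun x hx y hy => hC x (hJR x hx).1 y (hJR y hy).1)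
  obtain ⟨T, hT, hTc, hTm⟩ := exists_isMonoCycleSet (i := 3) (σ := σ)
    (K := J.filter fun x => ¬ p x)
    hPA hP' hd hB h0 h1 (by decide) (by decide) h3 ht (by omega)
    (hσ.mono (Finset.coe_subset.2 (Finset.filter_subset _ _))) (fun x hx => (hJB x hx).2.2)
    (fun x hx y hy => hD x (hJB x hx).1 y (hJB y hy).1)
  refine ⟨S, T, hS, hT, Finset.disjoint_left.2 fun v hv hv' => ?_, ?_⟩
  · have hne : ∀ x ∈ J.filter p, ∀ y ∈ J.filter fun x => ¬ p x, x ≠ y ∧ σ x ≠ σ y := by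
      intro x hx y hy
      rw [Finset.mem_filter] at hx hy
      have hxy : x ≠ y := fun h => hy.2 (h ▸ hx.2)
      exact ⟨hxy, fun h => hxy (hσ hx.1 hy.1 h)⟩
    rcases hSm v hv with ⟨x, hx⟩ | ⟨x, hxK, hx | hx⟩ <;>
    rcases hTm v hv' with ⟨y, hy⟩ | ⟨y, hyK, hy | hy⟩ <;>
    obtain ⟨e1, e2⟩ := hP' _ _ _ _ _ hx hy <;> revert e2 <;> try decide
    · exact fun _ => (hne x hxK y hyK).1 e1
    · exact fun _ => (hne x hxK y hyK).2 e1
  · have h4 := Finset.card_filter_add_card_filter_not (s := J) p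
    have h5 : (s : ℝ) - 15 * t ≤ ((2 * ((s - 6 * t) / 2) - 8 * t : ℕ) : ℝ) := by
      have : s ≤ 2 * ((s - 6 * t) / 2) - 8 * t + 15 * t := by omega
      have : (s : ℝ) ≤ ((2 * ((s - 6 * t) / 2) - 8 * t : ℕ) : ℝ) + 15 * t := by exact_mod_cast this
      linarith
    have h6 : (0 : ℝ) ≤ s - 15 * t := by
      have : ((20 * t : ℕ) : ℝ) ≤ s := by exact_mod_cast hts
      push_cast at this
      have : (0 : ℝ) ≤ t := by positivity
      linarith
    calc (1 - δ) * Fintype.card ι * (s - 15 * t) ≤ J.card * (s - 15 * t) := by gcongr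
      _ ≤ J.card * ((2 * ((s - 6 * t) / 2) - 8 * t : ℕ) : ℝ) := by gcongr
      _ ≤ S.card + T.card := by
        have : J.card * (2 * ((s - 6 * t) / 2) - 8 * t) ≤ S.card + T.card := by
          rw [← h4, add_mul]; exact add_le_add hSc hTc
        exact_mod_cast this

end Cycles

section Grouping

open scoped Classical

variable {V κ : Type*} [Fintype V] [LinearOrder κ]

/-- Consecutive classes of `f` can be grouped together so that there are few groups, none of them
is much larger than half, and few pairs from distinct classes end up in the same group. -/
lemma exists_grouping (f : V → κ) (hf : ∀ i, 2 * (Finset.univ.filter (f · = i)).card ≤ Fintype.card V)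
    {η : ℝ} (hη : 0 < η) :
    ∃ g : V → ℕ, (∀ u v, f u = f v → g u = g v) ∧ (∀ v, (g v : ℝ) ≤ 1 / η) ∧
      (∀ j, ((Finset.univ.filter (g · = j)).card : ℝ) ≤ (1 / 2 + η) * Fintype.card V) ∧
      ((Finset.univ.filter fun p : V × V => f p.1 ≠ f p.2 ∧ g p.1 = g p.2).card : ℝ) ≤
        2 * η * Fintype.card V ^ 2 := by
  rcases isEmpty_or_nonempty V with hV | hV
  · exact ⟨fun _ => 0, by simp, by simp [hη.le], by simp, by simp⟩
  have hn : (0 : ℝ) < Fintype.card V := by exact_mod_cast Fintype.card_pos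
  set n : ℝ := (Fintype.card V : ℝ) with hn_def
  set pre : V → ℕ := fun v => (Finset.univ.filter fun u => f u < f v).card with hpre
  set g : V → ℕ := fun v => ⌊(pre v : ℝ) / (η * n)⌋₊ with hg
  have key : ∀ v, ((Finset.univ.filter fun u => f u < f v ∧ g u = g v).card : ℝ) ≤ η * n := by
    intro v
    rcases (Finset.univ.filter fun u => f u < f v ∧ g u = g v).eq_empty_or_nonempty with he | he
    · rw [he]; simp; positivity
    obtain ⟨u₀, hu₀, hmin⟩ := Finset.exists_min_image _ f he
    obtain ⟨hu₀v, hg0⟩ := (Finset.mem_filter.1 hu₀).2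
    have h1 : (Finset.univ.filter fun u => f u < f v ∧ g u = g v).card + pre u₀ ≤ pre v := by
      rw [hpre, ← Finset.card_union_of_disjoint]
      · refine Finset.card_le_card fun u hu => ?_
        rcases Finset.mem_union.1 hu with hu | hu
        · simpa using (Finset.mem_filter.1 hu).2.1
        · simpa using (by simpa using hu : f u < f u₀).trans hu₀v
      · rw [Finset.disjoint_left]
        intro u hu hu'
        exact absurd (by simpa using hu' : f u < f u₀) (hmin u hu).not_gt
    have h2 : (pre v : ℝ) / (η * n) < g v + 1 := Nat.lt_floor_add_one _
    have h3 : (g u₀ : ℝ) ≤ (pre u₀ : ℝ) / (η * n) := Nat.floor_le (by positivity)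
    rw [div_lt_iff₀ (by positivity)] at h2
    rw [le_div_iff₀ (by positivity), hg0] at h3
    have h4 : ((Finset.univ.filter fun u => f u < f v ∧ g u = g v).card : ℝ) + pre u₀ ≤ pre v := by
      exact_mod_cast h1
    linarith
  refine ⟨g, fun u v huv => by simp [hg, hpre, huv], fun v => ?_, fun j => ?_, ?_⟩
  · refine (Nat.floor_le (by positivity)).trans ?_
    rw [div_le_div_iff₀ (by positivity) hη]
    have : (pre v : ℝ) ≤ n := by
      rw [hn_def]; exact_mod_cast Finset.card_le_univ (Finset.univ.filter fun u => f u < f v)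
    nlinarith
  · rcases (Finset.univ.filter (g · = j)).eq_empty_or_nonempty with he | he
    · rw [he]; simp; positivity
    obtain ⟨v, hv, hmax⟩ := Finset.exists_max_image _ f he
    have h1 := card_le_add_of_forall_mem_or (S := Finset.univ.filter (g · = j))
      (A := Finset.univ.filter fun u => f u < f v ∧ g u = g v)
      (T := Finset.univ.filter (f · = f v)) (fun u hu => by
        rcases (hmax u hu).lt_or_eq with h | h
        · left
          simp only [Finset.mem_filter, Finset.mem_univ, true_and] at hu hv ⊢
          exact ⟨h, hu.trans hv.symm⟩
        · right; simpa using h)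
    have h2 := key v
    have h3 : 2 * ((Finset.univ.filter (f · = f v)).card : ℝ) ≤ n := by
      rw [hn_def]; exact_mod_cast hf (f v)
    linarith
  · set E := Finset.univ.filter fun p : V × V => f p.1 < f p.2 ∧ g p.1 = g p.2 with hE
    have h1 : (E.card : ℝ) ≤ η * n * n := by
      have h2 : E.card = ∑ v : V, (Finset.univ.filter fun u => f u < f v ∧ g u = g v).card := by
        rw [hE, Finset.card_filter, Fintype.sum_prod_type_right]
        refine Finset.sum_congr rfl fun v _ => ?_
        rw [Finset.card_filter]
      rw [h2, Nat.cast_sum]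
      refine (Finset.sum_le_card_nsmul _ _ _ fun v _ => key v).trans ?_
      rw [Finset.card_univ, nsmul_eq_mul, mul_comm]
    have h2 := card_le_add_of_forall_mem_or
      (S := Finset.univ.filter fun p : V × V => f p.1 ≠ f p.2 ∧ g p.1 = g p.2)
      (A := E) (T := E.map (Equiv.prodComm V V).toEmbedding) (fun p hp => by
        obtain ⟨h3, h4⟩ := (Finset.mem_filter.1 hp).2
        rcases lt_or_gt_of_ne h3 with h | h
        · left; simp [hE, h, h4]
        · right
          rw [Finset.mem_map]
          exact ⟨p.swap, by simp [hE, h, h4], by simp⟩)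
    rw [Finset.card_map] at h2
    nlinarith

/-- The set `W` can be cut into pieces of size `s` on which `φ` is constant, up to few elements. -/
lemma exists_pieces {α : Type*} [DecidableEq α] (φ : V → α) (W : Finset V) {s m : ℕ}
    (hs : 0 < s) (hm : (W.image φ).card ≤ m) :
    ∃ F : Finset (Finset V), (∀ D ∈ F, D ⊆ W ∧ D.card = s ∧ ∀ u ∈ D, ∀ v ∈ D, φ u = φ v) ∧
      (∀ D ∈ F, ∀ D' ∈ F, D ≠ D' → Disjoint D D') ∧ W.card ≤ F.card * s + m * s := by
  set 𝓕 := (Finset.univ : Finset (Finset (Finset V))).filter fun F =>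
    (∀ D ∈ F, D ⊆ W ∧ D.card = s ∧ ∀ u ∈ D, ∀ v ∈ D, φ u = φ v) ∧
      (∀ D ∈ F, ∀ D' ∈ F, D ≠ D' → Disjoint D D') with h𝓕
  obtain ⟨F, hF, hmax⟩ := Finset.exists_max_image 𝓕 Finset.card ⟨∅, by simp [h𝓕]⟩
  obtain ⟨h1, h2⟩ := (Finset.mem_filter.1 hF).2
  refine ⟨F, h1, h2, ?_⟩
  have h3 : (F.biUnion id).card = F.card * s := by
    rw [Finset.card_biUnion (t := id) fun D hD D' hD' => h2 D hD D' hD',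
      Finset.sum_congr rfl fun D hD => show (id D).card = s from (h1 D hD).2.1, Finset.sum_const, smul_eq_mul]
  have h4 : (W \ F.biUnion id).card ≤ s * m := by
    refine (Finset.card_le_mul_card_image (f := φ) (W \ F.biUnion id) s fun a ha => ?_).trans
      (Nat.mul_le_mul_left _ ((Finset.card_le_card (Finset.image_subset_image
        Finset.sdiff_subset)).trans hm))
    by_contra! hlt
    obtain ⟨D, hD, hDs⟩ := Finset.exists_subset_card_eq hlt.le
    have hDm : ∀ v ∈ D, v ∈ W ∧ (∀ D' ∈ F, v ∉ D') ∧ φ v = a := by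
      intro v hv
      simpa [and_assoc] using hD hv
    have hdis : ∀ D' ∈ F, Disjoint D D' := fun D' hD' =>
      Finset.disjoint_left.2 fun v hv => (hDm v hv).2.1 D' hD'
    have hDF : D ∉ F := fun hDF => by
      have := hdis D hDF
      rw [disjoint_self, Finset.bot_eq_empty] at this
      rw [this, Finset.card_empty] at hDs
      omega
    have hins : insert D F ∈ 𝓕 := by
      refine Finset.mem_filter.2 ⟨Finset.mem_univ _, fun D₁ hD₁ => ?_, fun D₁ hD₁ D₂ hD₂ hne => ?_⟩
      · rcases Finset.mem_insert.1 hD₁ with rfl | hD₁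
        · exact ⟨fun v hv => (hDm v hv).1, hDs, fun u hu v hv => by
            rw [(hDm u hu).2.2, (hDm v hv).2.2]⟩
        · exact h1 D₁ hD₁
      · rcases Finset.mem_insert.1 hD₁ with rfl | hd₁ <;>
          rcases Finset.mem_insert.1 hD₂ with rfl | hd₂
        · exact absurd rfl hne
        · exact hdis D₂ hd₂
        · exact (hdis D₁ hd₁).symm
        · exact h2 D₁ hd₁ D₂ hd₂ hne
    have := hmax _ hins
    rw [Finset.card_insert_of_notMem hDF] at this
    omega
  have h5 := Finset.le_card_sdiff (F.biUnion id) W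
  rw [mul_comm m]
  omega

end Grouping

section Density

open scoped Classical

variable {V : Type*} {Γ : SimpleGraph V} {ε : ℝ} {X Y : Finset V} {t : ℕ}

lemma card_interedges_eq (Γ : SimpleGraph V) (X Y : Finset V) :
    ((Γ.interedges X Y).card : ℝ) = Γ.edgeDensity X Y * (X.card * Y.card) := by
  have h : ((Γ.interedges X Y).card : ℚ) ≤ X.card * Y.card := by
    exact_mod_cast Γ.card_interedges_le_mul X Y
  rw [edgeDensity_def]
  push_cast
  by_cases h0 : (X.card * Y.card : ℝ) = 0
  · have h1 : ((Γ.interedges X Y).card : ℝ) ≤ X.card * Y.card := by exact_mod_cast h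
    have h2 : (0 : ℝ) ≤ (Γ.interedges X Y).card := by positivity
    rw [h0, mul_zero]
    linarith
  · rw [div_mul_cancel₀ _ h0]

lemma SimpleGraph.IsUniform.joinedAt (h : Γ.IsUniform ε X Y) (hX : X.card * ε ≤ t)
    (hY : Y.card * ε ≤ t) (hd : ε ≤ Γ.edgeDensity X Y) : JoinedAt Γ t X Y := by
  intro A hA B hB hAt hBt
  have h1 := h hA hB (hX.trans (by exact_mod_cast hAt)) (hY.trans (by exact_mod_cast hBt))
  have h2 : (0 : ℝ) < Γ.edgeDensity A B := by
    have := (abs_lt.1 h1).1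
    linarith
  have h3 : (Γ.interedges A B).Nonempty := by
    rw [Finset.nonempty_iff_ne_empty]
    intro h0
    rw [edgeDensity_def, h0] at h2
    simp at h2
  obtain ⟨⟨a, b⟩, hab⟩ := h3
  rw [mem_interedges_iff] at hab
  exact ⟨a, hab.1, b, hab.2.1, hab.2.2⟩

lemma SimpleGraph.IsUniform.exists_not_adj (h : Γ.IsUniform ε X Y) (hX : X.card * ε ≤ t)
    (hY : Y.card * ε ≤ t) (hd : (Γ.edgeDensity X Y : ℝ) ≤ 1 - ε) (ht : 1 ≤ t) {A B : Finset V}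
    (hA : A ⊆ X) (hB : B ⊆ Y) (hAt : t ≤ A.card) (hBt : t ≤ B.card) :
    ∃ a ∈ A, ∃ b ∈ B, ¬ Γ.Adj a b := by
  have h1 := h hA hB (hX.trans (by exact_mod_cast hAt)) (hY.trans (by exact_mod_cast hBt))
  have h2 : (Γ.edgeDensity A B : ℝ) < 1 := by
    have := (abs_lt.1 h1).2
    linarith
  by_contra! hno
  have h3 : Γ.interedges A B = A ×ˢ B := by
    ext ⟨a, b⟩
    rw [mem_interedges_iff, Finset.mem_product]
    exact ⟨fun h => ⟨h.1, h.2.1⟩, fun h => ⟨h.1, h.2, hno a h.1 b h.2⟩⟩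
  have h4 := card_interedges_eq Γ A B
  rw [h3, Finset.card_product] at h4
  push_cast at h4
  have h5 : (0 : ℝ) < A.card * B.card := by
    have : 0 < A.card := by omega
    have : 0 < B.card := by omega
    positivity
  nlinarith

variable [Fintype V] {P : Finpartition (Finset.univ : Finset V)}

lemma card_pairs_le_mul_sq (P : Finpartition (Finset.univ : Finset V)) {d : ℝ} {r : V × V → Prop}
    [DecidablePred r] (hr : ∀ X ∈ P.parts, ∀ Y ∈ P.parts,
      (((X ×ˢ Y).filter r).card : ℝ) ≤ d * (X.card * Y.card)) :
    ((Finset.univ.filter r).card : ℝ) ≤ d * Fintype.card V ^ 2 := by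
  have h1 : Finset.univ.filter r ⊆
      (P.parts ×ˢ P.parts).biUnion fun Q => (Q.1 ×ˢ Q.2).filter r := by
    intro p hp
    rw [Finset.mem_biUnion]
    exact ⟨(P.part p.1, P.part p.2), by simp [P.part_mem], by
      simpa [P.mem_part] using hp⟩
  have h2 : ((Finset.univ.filter r).card : ℝ) ≤
      ∑ Q ∈ P.parts ×ˢ P.parts, (((Q.1 ×ˢ Q.2).filter r).card : ℝ) := by
    exact_mod_cast (Finset.card_le_card h1).trans Finset.card_biUnion_le
  refine h2.trans ((Finset.sum_le_sum fun Q hQ => hr Q.1 (Finset.mem_product.1 hQ).1 Q.2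
    (Finset.mem_product.1 hQ).2).trans_eq ?_)
  have h3 : ∑ X ∈ P.parts, (X.card : ℝ) = Fintype.card V := by
    rw [← Finset.card_univ]
    exact_mod_cast P.sum_card_parts
  rw [← Finset.mul_sum, Finset.sum_product, pow_two, ← h3, Finset.sum_mul_sum]

lemma card_adj_sparse_le (P : Finpartition (Finset.univ : Finset V)) {d : ℝ} (hd : 0 ≤ d) :
    ((Finset.univ.filter fun p : V × V => (Γ.edgeDensity (P.part p.1) (P.part p.2) : ℝ) < d ∧
      Γ.Adj p.1 p.2).card : ℝ) ≤ d * Fintype.card V ^ 2 := by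
  refine card_pairs_le_mul_sq P fun X hX Y hY => ?_
  by_cases h : (Γ.edgeDensity X Y : ℝ) < d
  · refine le_trans ?_ ((card_interedges_eq Γ X Y).trans_le (by gcongr))
    refine Nat.cast_le.2 (Finset.card_le_card fun p hp => ?_)
    rw [Finset.mem_filter, Finset.mem_product] at hp
    exact (mem_interedges_iff _).2 ⟨hp.1.1, hp.1.2, hp.2.2⟩
  · rw [Finset.filter_eq_empty_iff.2]
    · simp; positivity
    · intro p hp hp'
      rw [Finset.mem_product] at hp
      rw [P.part_eq_of_mem hX hp.1, P.part_eq_of_mem hY hp.2] at hp'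
      exact h hp'.1

lemma card_not_adj_dense_le (P : Finpartition (Finset.univ : Finset V)) {d : ℝ} (hd : 0 ≤ d) :
    ((Finset.univ.filter fun p : V × V => 1 - d < (Γ.edgeDensity (P.part p.1) (P.part p.2) : ℝ) ∧
      ¬ Γ.Adj p.1 p.2).card : ℝ) ≤ d * Fintype.card V ^ 2 := by
  refine card_pairs_le_mul_sq P fun X hX Y hY => ?_
  by_cases h : 1 - d < (Γ.edgeDensity X Y : ℝ)
  · have h1 : ((X ×ˢ Y).filter fun p : V × V => 1 - d < (Γ.edgeDensity (P.part p.1) (P.part p.2) : ℝ)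
        ∧ ¬ Γ.Adj p.1 p.2).card + (Γ.interedges X Y).card ≤ X.card * Y.card := by
      rw [← Finset.card_product, ← Finset.card_union_of_disjoint]
      · refine Finset.card_le_card fun p hp => ?_
        rcases Finset.mem_union.1 hp with hp | hp
        · exact (Finset.mem_filter.1 hp).1
        · rw [mem_interedges_iff] at hp
          exact Finset.mem_product.2 ⟨hp.1, hp.2.1⟩
      · refine Finset.disjoint_left.2 fun p hp hp' => ?_
        exact (Finset.mem_filter.1 hp).2.2 ((mem_interedges_iff _).1 hp').2.2
    have h2 := card_interedges_eq Γ X Y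
    have h3 : (0 : ℝ) ≤ X.card * Y.card := by positivity
    rify at h1
    nlinarith
  · rw [Finset.filter_eq_empty_iff.2]
    · simp; positivity
    · intro p hp hp'
      rw [Finset.mem_product] at hp
      rw [P.part_eq_of_mem hX hp.1, P.part_eq_of_mem hY hp.2] at hp'
      exact h hp'.1

lemma card_pairs_mem_le (P : Finpartition (Finset.univ : Finset V)) {a : ℝ}
    (ha : ∀ X ∈ P.parts, (X.card : ℝ) ≤ a) (S : Finset (Finset V × Finset V))
    (hS : ∀ Q ∈ S, Q.1 ∈ P.parts ∧ Q.2 ∈ P.parts) :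
    ((Finset.univ.filter fun p : V × V => (P.part p.1, P.part p.2) ∈ S).card : ℝ) ≤
      S.card * a ^ 2 := by
  have h1 : (Finset.univ.filter fun p : V × V => (P.part p.1, P.part p.2) ∈ S) ⊆
      S.biUnion fun Q => Q.1 ×ˢ Q.2 := by
    intro p hp
    rw [Finset.mem_biUnion]
    exact ⟨_, (Finset.mem_filter.1 hp).2, by simp [P.mem_part]⟩
  have h2 := (Finset.card_le_card h1).trans Finset.card_biUnion_le
  have h3 : ((Finset.univ.filter fun p : V × V => (P.part p.1, P.part p.2) ∈ S).card : ℝ) ≤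
      ∑ Q ∈ S, ((Q.1 ×ˢ Q.2).card : ℝ) := by exact_mod_cast h2
  refine h3.trans ((Finset.sum_le_card_nsmul _ _ (a ^ 2) fun Q hQ => ?_).trans_eq (nsmul_eq_mul _ _))
  rw [Finset.card_product, pow_two]
  push_cast
  obtain ⟨h4, h5⟩ := hS Q hQ
  have h6 := ha _ h4
  exact mul_le_mul h6 (ha _ h5) (by positivity) ((Nat.cast_nonneg _).trans h6)

/-- The parts forming an irregular pair with `X`. -/
noncomputable def irregularPartners (P : Finpartition (Finset.univ : Finset V)) (Γ : SimpleGraph V)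
    (ε : ℝ) (X : Finset V) : Finset (Finset V) :=
  P.parts.filter fun Y => X ≠ Y ∧ ¬ Γ.IsUniform ε X Y

lemma card_irregular_parts_le {η : ℝ} (hη : 0 < η) (hε : ε ≤ η ^ 2) (hε0 : 0 < ε)
    (hP : P.IsUniform Γ ε) :
    ((P.parts.filter fun X => η * P.parts.card < (irregularPartners P Γ ε X).card).card : ℝ) ≤
      η * P.parts.card := by
  set S := P.parts.filter fun X => η * P.parts.card < (irregularPartners P Γ ε X).card with hS
  have h1 : ∑ X ∈ S, (irregularPartners P Γ ε X).card ≤ (P.nonUniforms Γ ε).card := by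
    rw [← Finset.card_sigma]
    refine Finset.card_le_card_of_injOn (fun Q => (Q.1, Q.2)) (fun Q hQ => ?_) ?_
    · rw [Finset.mem_coe, Finset.mem_sigma] at hQ
      obtain ⟨h2, h3⟩ := hQ
      obtain ⟨h4, h5, h6⟩ := Finset.mem_filter.1 h3
      exact (P.mk_mem_nonUniforms Γ).2 ⟨(Finset.mem_filter.1 h2).1, h4, h5, h6⟩
    · rintro ⟨a, b⟩ - ⟨a', b'⟩ - h
      simp only [Prod.mk.injEq] at h
      obtain ⟨rfl, rfl⟩ := h
      rfl
  have h2 : (S.card : ℝ) * (η * P.parts.card) ≤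
      ∑ X ∈ S, ((irregularPartners P Γ ε X).card : ℝ) := by
    rw [← nsmul_eq_mul]
    exact Finset.card_nsmul_le_sum _ _ _ fun X hX => (Finset.mem_filter.1 hX).2.le
  have h3 : ((P.nonUniforms Γ ε).card : ℝ) ≤ P.parts.card ^ 2 * η ^ 2 := by
    refine hP.trans ?_
    have : (((P.parts.card * (P.parts.card - 1) : ℕ) : ℝ)) ≤ (P.parts.card : ℝ) ^ 2 := by
      rw [pow_two]
      exact_mod_cast Nat.mul_le_mul_left _ (Nat.sub_le _ _)
    gcongr
  have h4 : ∑ X ∈ S, ((irregularPartners P Γ ε X).card : ℝ) ≤ P.parts.card ^ 2 * η ^ 2 :=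
    le_trans (by exact_mod_cast h1) h3
  have h5 : (S.card : ℝ) ≤ P.parts.card := by
    exact_mod_cast Finset.card_le_card (Finset.filter_subset _ _)
  rcases (Nat.cast_nonneg (α := ℝ) P.parts.card).eq_or_lt with h0 | h0
  · rw [← h0] at h5 ⊢
    simpa using h5
  · have h6 : (0 : ℝ) < η * P.parts.card := by positivity
    have h7 : (S.card : ℝ) * (η * P.parts.card) ≤ (η * P.parts.card) * (η * P.parts.card) := by
      nlinarith
    exact le_of_mul_le_mul_right h7 h6

end Density

section Reduction

open scoped Classical

variable {V ι : Type*}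

lemma card_mul_le_of_subset {A : ι → Finset V} {s : ℕ}
    (hd : ∀ x y, x ≠ y → Disjoint (A x) (A y))
    (hs : ∀ x, (A x).card = s) {T : Finset ι} {Z : Finset V} (h : ∀ x ∈ T, A x ⊆ Z) :
    T.card * s ≤ Z.card := by
  have h1 : (T.biUnion A).card = T.card * s := by
    rw [Finset.card_biUnion fun x _ y _ => hd x y, Finset.sum_congr rfl fun x _ => hs x,
      Finset.sum_const, smul_eq_mul]
  rw [← h1]
  exact Finset.card_le_card (Finset.biUnion_subset.2 h)

variable [Fintype ι]

/-- A cluster graph for the colouring `c` of `G`, with disjoint clusters `A x` of size `s`: edges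
of `R` and `B` are pairs of clusters joined in red and blue, and all edges outside a small
exceptional set `E` respect the cluster graph. -/
structure IsReduction [Fintype V] (G : SimpleGraph V) (c : Sym2 V → Bool) (A : ι → Finset V)
    (g : ι → ℕ) (R B : SimpleGraph ι) (E : Finset (V × V)) (s t : ℕ) (η ρ : ℝ) : Prop where
  disjoint : ∀ x y, x ≠ y → Disjoint (A x) (A y)
  card_eq : ∀ x, (A x).card = s
  red : ∀ x y, R.Adj x y → JoinedAt (monoSubgraph G c true) t (A x) (A y)
  blue : ∀ x y, B.Adj x y → JoinedAt (monoSubgraph G c false) t (A x) (A y)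
  nearlyComplete : NearlyComplete R B g (8 * η)
  le_card_mul : (1 - 3 * η) * Fintype.card V ≤ Fintype.card ι * s
  card_exceptional : (E.card : ℝ) ≤ 20 * η * Fintype.card V ^ 2
  exists_mem : ∀ u v, (u, v) ∉ E → G.Adj u v → ∃ x y, u ∈ A x ∧ v ∈ A y ∧ g x ≠ g y ∧
    (¬ R.Adj x y → c s(u, v) = false) ∧ (¬ B.Adj x y → c s(u, v) = true)
  one_le : 1 ≤ t
  sq_card_le : Fintype.card ι ^ 2 ≤ t
  le_mul : (t : ℝ) ≤ ρ * s

/-- The graph whose edges are the uniform pairs of distinct clusters `cl x`, in distinct groups,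
with density satisfying `q`. -/
noncomputable def clusterGraph (Γ : SimpleGraph V) (ε : ℝ) (cl : ι → Finset V) (g : ι → ℕ)
    (q : ℝ → Prop) : SimpleGraph ι where
  Adj x y := cl x ≠ cl y ∧ g x ≠ g y ∧ Γ.IsUniform ε (cl x) (cl y) ∧
    q (Γ.edgeDensity (cl x) (cl y))
  symm := ⟨fun x y ⟨h1, h2, h3, h4⟩ => ⟨h1.symm, h2.symm, h3.symm, by rwa [edgeDensity_comm]⟩⟩
  loopless := ⟨fun x h => h.1 rfl⟩

variable {A cl : ι → Finset V} {g : ι → ℕ} {s : ℕ} {Γ : SimpleGraph V} {ε η a : ℝ}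

lemma card_missing_clusterGraph_mul_le [Fintype V] {P : Finpartition (Finset.univ : Finset V)}
    (hd : ∀ x y, x ≠ y → Disjoint (A x) (A y)) (hs : ∀ x, (A x).card = s)
    (hcl : ∀ x, cl x ∈ P.parts) (hA : ∀ x, A x ⊆ cl x)
    (ha : ∀ X ∈ P.parts, (X.card : ℝ) ≤ a) (hε : ε ≤ 1 / 4) (x : ι)
    (hx : ((irregularPartners P Γ ε (cl x)).card : ℝ) ≤ η * P.parts.card) :
    ((missing (clusterGraph Γ ε cl g (2 * ε ≤ ·)) (clusterGraph Γ ε cl g (· ≤ 1 - 2 * ε))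
      g x).card : ℝ) * s ≤ (η * P.parts.card + 1) * a := by
  set T := insert (cl x) (irregularPartners P Γ ε (cl x)) with hT
  have h1 : ((T.biUnion id).card : ℝ) ≤ T.card * a := by
    have h2 : ((T.biUnion id).card : ℝ) ≤ ∑ X ∈ T, (X.card : ℝ) := by
      exact_mod_cast Finset.card_biUnion_le (s := T) (t := id)
    refine h2.trans ((Finset.sum_le_card_nsmul _ _ a fun X hX => ha X ?_).trans_eq
      (nsmul_eq_mul _ _))
    rcases Finset.mem_insert.1 hX with rfl | hX
    · exact hcl x
    · exact (Finset.mem_filter.1 hX).1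
  have h3 : (T.card : ℝ) ≤ η * P.parts.card + 1 := by
    have : (T.card : ℝ) ≤ (irregularPartners P Γ ε (cl x)).card + 1 := by
      exact_mod_cast Finset.card_insert_le _ _
    linarith
  have ha0 : 0 ≤ a := (Nat.cast_nonneg _).trans (ha _ (hcl x))
  have h4 : (((missing (clusterGraph Γ ε cl g (2 * ε ≤ ·))
      (clusterGraph Γ ε cl g (· ≤ 1 - 2 * ε)) g x).card * s : ℕ) : ℝ) ≤ (T.biUnion id).card := by
    refine Nat.cast_le.2 (card_mul_le_of_subset hd hs fun y hy => (hA y).trans ?_)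
    refine Finset.subset_biUnion_of_mem id ?_
    obtain ⟨h5, h6, h7⟩ := (Finset.mem_filter.1 hy).2
    rw [hT, Finset.mem_insert]
    by_contra! h8
    have h9 : Γ.IsUniform ε (cl x) (cl y) := by
      by_contra h9
      exact h8.2 (Finset.mem_filter.2 ⟨hcl y, h8.1.symm, h9⟩)
    rcases le_total (2 * ε) (Γ.edgeDensity (cl x) (cl y) : ℝ) with h | h
    · exact h6 ⟨h8.1.symm, h5.symm, h9, h⟩
    · exact h7 ⟨h8.1.symm, h5.symm, h9, by linarith⟩
  rw [← Nat.cast_mul]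
  exact h4.trans (h1.trans (by gcongr))

lemma nearlyComplete_clusterGraph [Fintype V] {P : Finpartition (Finset.univ : Finset V)}
    (hd : ∀ x y, x ≠ y → Disjoint (A x) (A y)) (hs : ∀ x, (A x).card = s)
    (hcl : ∀ x, cl x ∈ P.parts) (hA : ∀ x, A x ⊆ cl x)
    (ha : ∀ X ∈ P.parts, (X.card : ℝ) * P.parts.card ≤ 2 * Fintype.card V) (hε : ε ≤ 1 / 4)
    (hx : ∀ x, ((irregularPartners P Γ ε (cl x)).card : ℝ) ≤ η * P.parts.card)
    {g' : V → ℕ} (hg : ∀ x, ∀ u ∈ A x, g' u = g x)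
    (hg' : ∀ j, ((Finset.univ.filter (g' · = j)).card : ℝ) ≤ (1 / 2 + η) * Fintype.card V)
    (hη : 0 < η) (hη' : η ≤ 1 / 10) (hP : 1 ≤ η * P.parts.card) (hs0 : 0 < s)
    (hcov : (1 - 3 * η) * Fintype.card V ≤ Fintype.card ι * s) :
    NearlyComplete (clusterGraph Γ ε cl g (2 * ε ≤ ·)) (clusterGraph Γ ε cl g (· ≤ 1 - 2 * ε)) g
      (8 * η) := by
  have hs1 : (0 : ℝ) < s := by exact_mod_cast hs0
  have hM : (0 : ℝ) < P.parts.card := by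
    by_contra! h
    nlinarith
  have hn : (0 : ℝ) ≤ Fintype.card V := by positivity
  refine ⟨fun j => ?_, fun x => ?_⟩
  · have h1 : (((Finset.univ.filter (g · = j)).card * s : ℕ) : ℝ) ≤
        (Finset.univ.filter (g' · = j)).card :=
      Nat.cast_le.2 (card_mul_le_of_subset hd hs fun x hx u hu => by
        simpa [hg x u hu] using hx)
    push_cast at h1
    refine le_of_mul_le_mul_right ?_ hs1
    refine h1.trans ((hg' j).trans ?_)
    have h2 : (1 / 2 + 8 * η) * ((1 - 3 * η) * Fintype.card V) ≤
        (1 / 2 + 8 * η) * (Fintype.card ι * s) := by gcongr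
    have h3 : (1 / 2 + η) * (Fintype.card V : ℝ) ≤
        (1 / 2 + 8 * η) * (1 - 3 * η) * Fintype.card V := by
      gcongr
      nlinarith
    linarith
  · have h1 := card_missing_clusterGraph_mul_le (g := g) hd hs hcl hA (a := 2 * Fintype.card V / P.parts.card)
      (fun X hX => by rw [le_div_iff₀ hM]; exact ha X hX) hε x (hx x)
    refine le_of_mul_le_mul_right (h1.trans ?_) hs1
    rw [mul_div_assoc', div_le_iff₀ hM]
    have h2 : (η * P.parts.card + 1) * (2 * Fintype.card V) ≤
        (η * P.parts.card + η * P.parts.card) * (2 * (Fintype.card V : ℝ)) := by gcongr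
    have h3 : 8 * η * P.parts.card * ((1 - 3 * η) * Fintype.card V) ≤
        8 * η * P.parts.card * (Fintype.card ι * s) := by gcongr
    have h4 : 8 * η * P.parts.card * (1 / 2 * Fintype.card V) ≤
        8 * η * P.parts.card * ((1 - 3 * η) * Fintype.card V) := by
      gcongr
      linarith
    linarith

end Reduction

section Exceptional

open scoped Classical

variable {V : Type*} [Fintype V]

/-- The pairs which are not respected by the cluster graph of the partition `P` restricted to the
vertices in `U`. -/
noncomputable def exceptionalPairs (G Γ : SimpleGraph V) (P : Finpartition (Finset.univ : Finset V))
    (ε : ℝ) (g : V → ℕ) (U : Finset V) : Finset (V × V) :=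
  Finset.univ.filter fun p => (p.1 ∉ U ∨ p.2 ∉ U) ∨ (G.Adj p.1 p.2 ∧ g p.1 = g p.2) ∨
    (P.part p.1 = P.part p.2 ∨ ¬ Γ.IsUniform ε (P.part p.1) (P.part p.2)) ∨
    ((Γ.edgeDensity (P.part p.1) (P.part p.2) : ℝ) < 2 * ε ∧ Γ.Adj p.1 p.2) ∨
    (1 - 2 * ε < (Γ.edgeDensity (P.part p.1) (P.part p.2) : ℝ) ∧ ¬ Γ.Adj p.1 p.2)

lemma card_not_mem_or_le (U : Finset V) :
    ((Finset.univ.filter fun p : V × V => p.1 ∉ U ∨ p.2 ∉ U).card : ℝ) ≤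
      2 * (Uᶜ.card * Fintype.card V) := by
  have h := card_le_add_of_forall_mem_or
    (S := Finset.univ.filter fun p : V × V => p.1 ∉ U ∨ p.2 ∉ U)
    (A := Uᶜ ×ˢ Finset.univ) (T := Finset.univ ×ˢ Uᶜ) (fun p hp => by
      simpa using hp)
  rw [Finset.card_product, Finset.card_product, Finset.card_univ] at h
  push_cast at h
  linarith

lemma card_part_eq_or_not_uniform_le {P : Finpartition (Finset.univ : Finset V)}
    {Γ : SimpleGraph V} {ε η : ℝ} (hP : P.IsUniform Γ ε) (hε0 : 0 < ε)
    (ha : ∀ X ∈ P.parts, (X.card : ℝ) * P.parts.card ≤ 2 * Fintype.card V)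
    (hε : ε ≤ η) (hM : 1 ≤ η * P.parts.card) :
    ((Finset.univ.filter fun p : V × V => P.part p.1 = P.part p.2 ∨
      ¬ Γ.IsUniform ε (P.part p.1) (P.part p.2)).card : ℝ) ≤ 8 * η * Fintype.card V ^ 2 := by
  have hM0 : (0 : ℝ) < P.parts.card := by
    by_contra! h
    nlinarith
  set S := P.nonUniforms Γ ε ∪ P.parts.image fun X => (X, X) with hS
  have h1 := card_pairs_mem_le P (a := 2 * Fintype.card V / P.parts.card)
    (fun X hX => by rw [le_div_iff₀ hM0]; exact ha X hX) S (fun Q hQ => by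
      rcases Finset.mem_union.1 hQ with hQ | hQ
      · obtain ⟨X, Y⟩ := Q
        have := (P.mk_mem_nonUniforms Γ).1 hQ
        exact ⟨this.1, this.2.1⟩
      · obtain ⟨X, hX, rfl⟩ := Finset.mem_image.1 hQ
        exact ⟨hX, hX⟩)
  have h2 : (S.card : ℝ) ≤ P.parts.card ^ 2 * ε + P.parts.card := by
    have h3 : (S.card : ℝ) ≤ (P.nonUniforms Γ ε).card + P.parts.card := by
      exact_mod_cast (Finset.card_union_le _ _).trans
        (Nat.add_le_add_left Finset.card_image_le _)
    have h4 : (((P.parts.card * (P.parts.card - 1) : ℕ) : ℝ)) ≤ (P.parts.card : ℝ) ^ 2 := by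
      rw [pow_two]
      exact_mod_cast Nat.mul_le_mul_left _ (Nat.sub_le _ _)
    have h5 : ((P.nonUniforms Γ ε).card : ℝ) ≤ P.parts.card ^ 2 * ε :=
      hP.trans (by gcongr)
    linarith
  have h3 : (Finset.univ.filter fun p : V × V => P.part p.1 = P.part p.2 ∨
      ¬ Γ.IsUniform ε (P.part p.1) (P.part p.2)) ⊆
      Finset.univ.filter fun p : V × V => (P.part p.1, P.part p.2) ∈ S := by
    intro p hp
    rw [Finset.mem_filter] at hp ⊢
    refine ⟨hp.1, Finset.mem_union.2 ?_⟩
    by_cases h : P.part p.1 = P.part p.2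
    · right
      rw [← h]
      exact Finset.mem_image_of_mem _ (P.part_mem.2 (Finset.mem_univ _))
    · left
      exact (P.mk_mem_nonUniforms Γ).2 ⟨P.part_mem.2 (Finset.mem_univ _),
        P.part_mem.2 (Finset.mem_univ _), h, hp.2.resolve_left h⟩
  refine (Nat.cast_le.2 (Finset.card_le_card h3)).trans (h1.trans ?_)
  rw [div_pow, mul_div_assoc', div_le_iff₀ (by positivity)]
  have h4 : (P.parts.card : ℝ) ^ 2 * ε + P.parts.card ≤ 2 * η * P.parts.card ^ 2 := by
    have : (P.parts.card : ℝ) ≤ η * P.parts.card * P.parts.card :=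
      le_mul_of_one_le_left hM0.le hM
    have : (P.parts.card : ℝ) ^ 2 * ε ≤ P.parts.card ^ 2 * η := by gcongr
    linarith
  have h5 : (S.card : ℝ) * (2 * (Fintype.card V : ℝ)) ^ 2 ≤
      (2 * η * P.parts.card ^ 2) * (2 * (Fintype.card V : ℝ)) ^ 2 := by
    gcongr
    exact h2.trans h4
  linarith

lemma card_exceptionalPairs_le {G Γ : SimpleGraph V} {P : Finpartition (Finset.univ : Finset V)}
    {ε η : ℝ} {g : V → ℕ} {U : Finset V} (hP : P.IsUniform Γ ε) (hε0 : 0 < ε) (hε : ε ≤ η)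
    (ha : ∀ X ∈ P.parts, (X.card : ℝ) * P.parts.card ≤ 2 * Fintype.card V)
    (hM : 1 ≤ η * P.parts.card) (hU : (Uᶜ.card : ℝ) ≤ 3 * η * Fintype.card V)
    (hg : ((Finset.univ.filter fun p : V × V => G.Adj p.1 p.2 ∧ g p.1 = g p.2).card : ℝ) ≤
      2 * η * Fintype.card V ^ 2) :
    ((exceptionalPairs G Γ P ε g U).card : ℝ) ≤ 20 * η * Fintype.card V ^ 2 := by
  have h1 := card_not_mem_or_le U
  have h2 := card_part_eq_or_not_uniform_le hP hε0 ha hε hM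
  have h3 := card_adj_sparse_le (Γ := Γ) P (d := 2 * ε) (by positivity)
  have h4 := card_not_adj_dense_le (Γ := Γ) P (d := 2 * ε) (by positivity)
  have h5 : 2 * ε * (Fintype.card V : ℝ) ^ 2 ≤ 2 * η * Fintype.card V ^ 2 := by gcongr
  have h6 : (Uᶜ.card : ℝ) * Fintype.card V ≤ 3 * η * Fintype.card V * Fintype.card V := by gcongr
  have h7 : ∀ E₁ E₂ E₃ E₄ E₅ : Finset (V × V),
      (((E₁ ∪ (E₂ ∪ (E₃ ∪ (E₄ ∪ E₅)))).card : ℕ) : ℝ) ≤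
        E₁.card + (E₂.card + (E₃.card + (E₄.card + E₅.card))) := by
    intro E₁ E₂ E₃ E₄ E₅
    have := Finset.card_union_le E₁ (E₂ ∪ (E₃ ∪ (E₄ ∪ E₅)))
    have := Finset.card_union_le E₂ (E₃ ∪ (E₄ ∪ E₅))
    have := Finset.card_union_le E₃ (E₄ ∪ E₅)
    have := Finset.card_union_le E₄ E₅
    norm_cast
    omega
  refine (Nat.cast_le.2 (Finset.card_le_card ?_)).trans ((h7 _ _ _ _ _).trans
    ((add_le_add h1 (add_le_add hg (add_le_add h2 (add_le_add h3 h4)))).trans (by linarith)))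
  intro p hp
  simpa only [exceptionalPairs, Finset.mem_filter, Finset.mem_union, Finset.mem_univ,
    true_and] using hp

end Exceptional

section ExistsReduction

open scoped Classical

lemma card_part_mem_mul_le {V : Type*} [Fintype V] {P : Finpartition (Finset.univ : Finset V)}
    {Z : Finset (Finset V)} (hZ : Z ⊆ P.parts) {a : ℝ} (ha : ∀ X ∈ P.parts, (X.card : ℝ) ≤ a) :
    ((Finset.univ.filter fun v => P.part v ∈ Z).card : ℝ) ≤ Z.card * a := by
  have h1 : (Finset.univ.filter fun v => P.part v ∈ Z) ⊆ Z.biUnion id := fun v hv =>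
    Finset.mem_biUnion.2 ⟨_, (Finset.mem_filter.1 hv).2, P.mem_part (Finset.mem_univ _)⟩
  have h2 : ((Finset.univ.filter fun v => P.part v ∈ Z).card : ℝ) ≤ ∑ X ∈ Z, (X.card : ℝ) := by
    exact_mod_cast (Finset.card_le_card h1).trans (Finset.card_biUnion_le (t := id))
  exact h2.trans ((Finset.sum_le_card_nsmul _ _ a fun X hX => ha X (hZ hX)).trans_eq
    (nsmul_eq_mul _ _))

lemma exists_isReduction_of_finpartition {V κ : Type} [Fintype V] {f : V → κ} {G : SimpleGraph V}
    {c : Sym2 V → Bool} (hG : ∀ x y, G.Adj x y ↔ f x ≠ f y) {η ε ρ : ℝ} {g : V → ℕ} {K s t : ℕ}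
    {P : Finpartition (Finset.univ : Finset V)} (hη : 0 < η) (hη' : η ≤ 1 / 10)
    (hfg : ∀ u v, f u = f v → g u = g v) (hgK : ∀ v, g v < K)
    (hg : ∀ j, ((Finset.univ.filter (g · = j)).card : ℝ) ≤ (1 / 2 + η) * Fintype.card V)
    (hg' : ((Finset.univ.filter fun p : V × V => f p.1 ≠ f p.2 ∧ g p.1 = g p.2).card : ℝ) ≤
      2 * η * Fintype.card V ^ 2)
    (hP : P.IsUniform (monoSubgraph G c true) ε) (hε0 : 0 < ε) (hε : ε ≤ η ^ 2)
    (ha : ∀ X ∈ P.parts, (X.card : ℝ) * P.parts.card ≤ 2 * Fintype.card V)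
    (hM : 1 ≤ η * P.parts.card) (hs : 0 < s)
    (hKs : (P.parts.card * K * s : ℝ) ≤ η * Fintype.card V)
    (ht : 2 * ε * Fintype.card V ≤ t * P.parts.card) (ht1 : 1 ≤ t) (hts : (t : ℝ) ≤ ρ * s)
    (hN : ∀ N : ℕ, N * s ≤ Fintype.card V → N ^ 2 ≤ t) :
    ∃ (ι : Type) (_ : Fintype ι) (A : ι → Finset V) (g : ι → ℕ) (R B : SimpleGraph ι)
      (E : Finset (V × V)), IsReduction G c A g R B E s t η ρ := by
  set Γ := monoSubgraph G c true with hΓ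
  have hM0 : (0 : ℝ) < P.parts.card := by
    by_contra! h
    nlinarith
  have ha' : ∀ X ∈ P.parts, (X.card : ℝ) ≤ 2 * Fintype.card V / P.parts.card := fun X hX => by
    rw [le_div_iff₀ hM0]
    exact ha X hX
  have hεη : ε ≤ η := by nlinarith
  have hε4 : ε ≤ 1 / 4 := by linarith
  set Z := P.parts.filter fun X => η * P.parts.card < (irregularPartners P Γ ε X).card with hZ
  have hZc : (Z.card : ℝ) ≤ η * P.parts.card := card_irregular_parts_le hη hε hε0 hP
  set W := (Finset.univ.filter fun v => P.part v ∈ Z)ᶜ with hW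
  have hWc : (Wᶜ.card : ℝ) ≤ 2 * η * Fintype.card V := by
    have h1 := card_part_mem_mul_le (Finset.filter_subset _ _ : Z ⊆ P.parts) ha'
    rw [hW, compl_compl]
    refine h1.trans ?_
    rw [mul_div_assoc', div_le_iff₀ hM0]
    have : (Z.card : ℝ) * (2 * Fintype.card V) ≤ η * P.parts.card * (2 * Fintype.card V) := by
      gcongr
    linarith
  obtain ⟨F, hF, hFd, hFc⟩ := exists_pieces (fun v => (P.part v, g v)) W
    (m := P.parts.card * K) hs (by
      rw [← Finset.card_range K, ← Finset.card_product]
      refine Finset.card_le_card fun x hx => ?_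
      obtain ⟨v, -, rfl⟩ := Finset.mem_image.1 hx
      exact Finset.mem_product.2 ⟨P.part_mem.2 (Finset.mem_univ _), Finset.mem_range.2 (hgK v)⟩)
  let A : F → Finset V := fun D => D.1
  have hAs : ∀ D, (A D).card = s := fun D => (hF D.1 D.2).2.1
  have hAd : ∀ D D', D ≠ D' → Disjoint (A D) (A D') := fun D D' h =>
    hFd D.1 D.2 D'.1 D'.2 fun h' => h (Subtype.ext h')
  have hne : ∀ D : F, ∃ u, u ∈ A D := fun D =>
    Finset.card_pos.1 (hs.trans_eq (hAs D).symm)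
  choose r hr using hne
  let cl : F → Finset V := fun D => P.part (r D)
  let γ : F → ℕ := fun D => g (r D)
  have hcl : ∀ D, ∀ u ∈ A D, P.part u = cl D := fun D u hu =>
    congrArg Prod.fst ((hF D.1 D.2).2.2 u hu _ (hr D))
  have hγ : ∀ D, ∀ u ∈ A D, g u = γ D := fun D u hu =>
    congrArg Prod.snd ((hF D.1 D.2).2.2 u hu _ (hr D))
  have hclP : ∀ D, cl D ∈ P.parts := fun D => P.part_mem.2 (Finset.mem_univ _)
  have hAcl : ∀ D, A D ⊆ cl D := fun D u hu => by
    rw [← hcl D u hu]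
    exact P.mem_part (Finset.mem_univ _)
  have hx : ∀ D, ((irregularPartners P Γ ε (cl D)).card : ℝ) ≤ η * P.parts.card := by
    intro D
    by_contra! h
    have h1 := (hF D.1 D.2).1 (hr D)
    rw [hW, Finset.mem_compl, Finset.mem_filter] at h1
    exact h1 ⟨Finset.mem_univ _, Finset.mem_filter.2 ⟨hclP D, h⟩⟩
  set U := F.biUnion id with hU
  have hUc : U.card = Fintype.card F * s := by
    rw [hU, Finset.card_biUnion (t := id) fun D hD D' hD' => hFd D hD D' hD', Fintype.card_coe,
      Finset.sum_congr rfl fun D hD => show (id D).card = s from (hF D hD).2.1,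
      Finset.sum_const, smul_eq_mul]
  have hcov : (1 - 3 * η) * Fintype.card V ≤ Fintype.card F * s := by
    have h1 : (W.card : ℝ) ≤ F.card * s + P.parts.card * K * s := by exact_mod_cast hFc
    have h2 : (W.card : ℝ) + Wᶜ.card = Fintype.card V := by
      exact_mod_cast Finset.card_add_card_compl W
    rw [Fintype.card_coe]
    linarith
  have hUc' : (Uᶜ.card : ℝ) ≤ 3 * η * Fintype.card V := by
    have h1 : (U.card : ℝ) = Fintype.card F * s := by exact_mod_cast hUc
    have h2 : (U.card : ℝ) + Uᶜ.card = Fintype.card V := by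
      exact_mod_cast Finset.card_add_card_compl U
    linarith
  have hpt : ∀ X ∈ P.parts, (X.card : ℝ) * ε ≤ t := fun X hX => by
    refine le_of_mul_le_mul_right ?_ hM0
    have := mul_le_mul_of_nonneg_right (ha X hX) hε0.le
    linarith
  refine ⟨F, inferInstance, A, γ, clusterGraph Γ ε cl γ (2 * ε ≤ ·),
    clusterGraph Γ ε cl γ (· ≤ 1 - 2 * ε), exceptionalPairs G Γ P ε g U, hAd, hAs, ?_, ?_,
    nearlyComplete_clusterGraph hAd hAs hclP hAcl ha hε4 hx hγ hg hη hη' hM hs hcov, hcov,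
    card_exceptionalPairs_le hP hε0 hεη ha hM hUc' (by simpa only [hG] using hg'), ?_, ht1,
    hN _ ?_, hts⟩
  · rintro D D' ⟨-, -, h1, h2⟩ X hX Y hY
    exact h1.joinedAt (hpt _ (hclP D)) (hpt _ (hclP D')) (by linarith) X (hX.trans (hAcl D)) Y
      (hY.trans (hAcl D'))
  · rintro D D' ⟨-, hne, h1, h2⟩ X hX Y hY hXt hYt
    obtain ⟨x, hx, y, hy, hxy⟩ := h1.exists_not_adj (hpt _ (hclP D)) (hpt _ (hclP D'))
      (by linarith) ht1 (hX.trans (hAcl D)) (hY.trans (hAcl D')) hXt hYt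
    have h3 : G.Adj x y := (hG x y).2 fun h => hne (by
      rw [← hγ D x (hX hx), ← hγ D' y (hY hy)]
      exact hfg _ _ h)
    refine ⟨x, hx, y, hy, monoSubgraph_adj.2 ⟨h3, ?_⟩⟩
    rw [hΓ, monoSubgraph_adj] at hxy
    simpa [h3] using hxy
  · intro u v huv hadj
    simp only [exceptionalPairs, Finset.mem_filter, Finset.mem_univ, true_and, not_or, not_and,
      not_not] at huv
    obtain ⟨⟨h1, h2⟩, h3, ⟨h4, h5⟩, h6, h7⟩ := huv
    obtain ⟨D, hD, hu⟩ := Finset.mem_biUnion.1 h1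
    obtain ⟨D', hD', hv⟩ := Finset.mem_biUnion.1 h2
    have hu' := hcl ⟨D, hD⟩ u hu
    have hv' := hcl ⟨D', hD'⟩ v hv
    have hgu := hγ ⟨D, hD⟩ u hu
    have hgv := hγ ⟨D', hD'⟩ v hv
    have hne := h3 hadj
    rw [hu', hv'] at h4 h5 h6 h7
    rw [hgu, hgv] at hne
    refine ⟨⟨D, hD⟩, ⟨D', hD'⟩, hu, hv, hne, fun h => ?_, fun h => ?_⟩
    · have h8 : ¬ Γ.Adj u v := fun h9 => h ⟨h4, hne, h5, by
        by_contra! h10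
        exact h6 h10 h9⟩
      rw [hΓ, monoSubgraph_adj] at h8
      simpa [hadj] using h8
    · have h8 : Γ.Adj u v := h7 (by
        by_contra! h10
        exact h ⟨h4, hne, h5, h10⟩)
      exact (monoSubgraph_adj.1 h8).2
  · exact_mod_cast hUc ▸ Finset.card_le_univ U

end ExistsReduction

section ReductionParameters

open scoped Classical

lemma exists_isReduction {η ρ : ℝ} (hη : 0 < η) (hη' : η ≤ 1 / 10) (hρ : 0 < ρ) (hρ' : ρ ≤ 1) :
    ∃ n₀ : ℕ, ∀ (V κ : Type) [Fintype V] [LinearOrder κ] (f : V → κ) (G : SimpleGraph V)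
      (c : Sym2 V → Bool), (∀ x y, G.Adj x y ↔ f x ≠ f y) →
      (∀ i, 2 * (Finset.univ.filter (f · = i)).card ≤ Fintype.card V) → n₀ < Fintype.card V →
      ∃ (ι : Type) (_ : Fintype ι) (A : ι → Finset V) (g : ι → ℕ) (R B : SimpleGraph ι)
        (E : Finset (V × V)) (s t : ℕ), IsReduction G c A g R B E s t η ρ := by
  set K : ℕ := ⌊1 / η⌋₊ + 1 with hK
  have hK0 : (0 : ℝ) < K := by positivity
  set l : ℕ := ⌈1 / η⌉₊ with hl
  set ε : ℝ := min (η ^ 2) (ρ * η / (4 * K)) with hε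
  have hε0 : 0 < ε := by positivity
  set M₁ : ℕ := SzemerediRegularity.bound ε l with hM₁
  set Q : ℝ := 2 * K * M₁ / η with hQ
  set Y : ℝ := 4 * K / (ρ * η) + Q ^ 2 / ε with hY
  refine ⟨l + M₁ + ⌈Y * M₁⌉₊, fun V κ _ _ f G c hG hf hn => ?_⟩
  obtain ⟨g, hfg, hgK, hg, hg'⟩ := exists_grouping f hf hη
  obtain ⟨P, hPe, hlP, hPM, hP⟩ := szemeredi_regularity (G := monoSubgraph G c true) hε0
    (l := l) (by omega)
  have hl0 : 0 < l := Nat.ceil_pos.2 (by positivity)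
  have hM0 : 0 < P.parts.card := by omega
  have hM : (0 : ℝ) < P.parts.card := by exact_mod_cast hM0
  have hn0 : (0 : ℝ) < Fintype.card V := by
    have : 0 < Fintype.card V := by omega
    exact_mod_cast this
  have hMM₁ : (P.parts.card : ℝ) ≤ M₁ := by exact_mod_cast hPM
  set y : ℝ := Fintype.card V / P.parts.card with hy
  have hyM : y * P.parts.card = Fintype.card V := div_mul_cancel₀ _ hM.ne'
  have hy0 : 0 < y := by positivity
  have hYy : Y ≤ y := by
    rw [hy, le_div_iff₀ hM]
    have h1 : (⌈Y * M₁⌉₊ : ℝ) ≤ Fintype.card V := by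
      have : ⌈Y * M₁⌉₊ ≤ Fintype.card V := by omega
      exact_mod_cast this
    exact (mul_le_mul_of_nonneg_left hMM₁ (by positivity)).trans ((Nat.le_ceil _).trans h1)
  have hy1 : 4 * K ≤ ρ * η * y := by
    have : 4 * K / (ρ * η) ≤ y := le_trans (le_add_of_nonneg_right (by positivity)) hYy
    rwa [div_le_iff₀' (by positivity)] at this
  have hy2 : Q ^ 2 ≤ ε * y := by
    have : Q ^ 2 / ε ≤ y := le_trans (le_add_of_nonneg_left (by positivity)) hYy
    rwa [div_le_iff₀' (by positivity)] at this
  have hεK : ε * (4 * K) ≤ ρ * η := by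
    rw [← le_div_iff₀ (by positivity)]
    exact min_le_right _ _
  set z : ℝ := η * y / K with hz
  have hzK : z * K = η * y := div_mul_cancel₀ _ hK0.ne'
  have hz1 : 4 ≤ ρ * z := by
    have : 4 * K ≤ ρ * z * K := by rw [mul_assoc, hzK]; linarith
    exact le_of_mul_le_mul_right this hK0
  have hεz : 4 * (ε * y) ≤ ρ * z := by
    refine le_of_mul_le_mul_right (a := (K : ℝ)) ?_ hK0
    have := mul_le_mul_of_nonneg_right hεK hy0.le
    rw [mul_assoc ρ z, hzK]
    linarith
  have hz4 : 4 ≤ z := by nlinarith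
  have hs1 : z < (⌊z⌋₊ : ℝ) + 1 := Nat.lt_floor_add_one z
  have hs2 : (⌊z⌋₊ : ℝ) ≤ z := Nat.floor_le (by linarith)
  have ht1 : 2 * (ε * y) ≤ (⌈2 * (ε * y)⌉₊ : ℝ) := Nat.le_ceil _
  have ht2 : (⌈2 * (ε * y)⌉₊ : ℝ) < 2 * (ε * y) + 1 := Nat.ceil_lt_add_one (by positivity)
  obtain ⟨ι, hι, A, γ, R, B, E, h⟩ := exists_isReduction_of_finpartition (c := c) (ρ := ρ) (K := K)
    (s := ⌊z⌋₊) (t := ⌈2 * (ε * y)⌉₊) hG hη hη' hfg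
    (fun v => by
      have : g v ≤ ⌊1 / η⌋₊ := Nat.le_floor (hgK v)
      omega) hg (by convert hg') hP hε0 (min_le_left _ _)
    (fun X hX => by
      have h1 : X.card ≤ Fintype.card V / P.parts.card + 1 := by
        simpa using hPe.card_part_le_average_add_one hX
      have h2 : X.card * P.parts.card ≤ 2 * Fintype.card V := by
        calc X.card * P.parts.card ≤ (Fintype.card V / P.parts.card + 1) * P.parts.card :=
              Nat.mul_le_mul_right _ h1
          _ = Fintype.card V / P.parts.card * P.parts.card + P.parts.card := by ring
          _ ≤ Fintype.card V + Fintype.card V :=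
              Nat.add_le_add (Nat.div_mul_le_self _ _) (by omega)
          _ = 2 * Fintype.card V := by ring
      exact_mod_cast h2)
    (by
      have h1 : 1 / η ≤ P.parts.card := (Nat.le_ceil _).trans (by exact_mod_cast hlP)
      rwa [div_le_iff₀' hη] at h1)
    (Nat.floor_pos.2 (by linarith))
    (by
      rw [← hyM]
      have : (P.parts.card * K * ⌊z⌋₊ : ℝ) ≤ P.parts.card * K * z := by gcongr
      refine this.trans_eq ?_
      rw [mul_assoc, mul_comm (K : ℝ), hzK]
      ring)
    (by
      rw [← hyM, ← mul_assoc]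
      exact mul_le_mul_of_nonneg_right (by linarith) hM.le)
    (Nat.ceil_pos.2 (by positivity))
    (by nlinarith)
    (fun N hN => by
      have h1 : (N : ℝ) * ⌊z⌋₊ ≤ Fintype.card V := by exact_mod_cast hN
      have h2 : (N : ℝ) ≤ Q := by
        have h3 : z / 2 ≤ (⌊z⌋₊ : ℝ) := by linarith
        have h4 : (N : ℝ) * (z / 2) ≤ y * M₁ := by
          refine (mul_le_mul_of_nonneg_left h3 (by positivity)).trans (h1.trans ?_)
          rw [← hyM]
          gcongr
        rw [hQ, le_div_iff₀ hη]
        refine le_of_mul_le_mul_right (a := y) ?_ hy0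
        have h5 := mul_le_mul_of_nonneg_right h4 (by positivity : (0 : ℝ) ≤ 2 * K)
        have h6 : (N : ℝ) * (z / 2) * (2 * K) = N * η * y := by
          rw [mul_assoc (N : ℝ) η, ← hzK]
          ring
        linarith
      have h3 : (N : ℝ) ^ 2 ≤ ⌈2 * (ε * y)⌉₊ := by
        have : (N : ℝ) ^ 2 ≤ Q ^ 2 := by gcongr
        have : 0 ≤ ε * y := by positivity
        linarith
      exact_mod_cast h3)
  exact ⟨ι, hι, A, γ, R, B, E, _, _, h⟩

end ReductionParameters

section Close

open scoped Classical

variable {V : Type*} {G : SimpleGraph V} {c : Sym2 V → Bool}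

lemma closeToSplit_mono {δ δ' : ℝ} (h : CloseToSplit G c δ) (hδ : δ ≤ δ') :
    CloseToSplit G c δ' := by
  obtain ⟨F, hF, hFc, h⟩ := h
  exact ⟨F, hF, hFc.trans (by gcongr), h⟩

lemma sq_card_le_four_mul_ncard_edgeSet [Fintype V] {κ : Type*} {f : V → κ}
    (hG : ∀ x y, G.Adj x y ↔ f x ≠ f y)
    (hf : ∀ i, 2 * (Finset.univ.filter (f · = i)).card ≤ Fintype.card V) :
    Fintype.card V ^ 2 ≤ 4 * G.edgeSet.ncard := by
  have h1 : ∀ v, Fintype.card V ≤ 2 * G.degree v := by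
    intro v
    have h2 : G.neighborFinset v = (Finset.univ.filter (f · = f v))ᶜ := by
      ext u
      simp [hG, eq_comm]
    have h3 := Finset.card_add_card_compl (Finset.univ.filter (f · = f v))
    rw [← h2, card_neighborFinset_eq_degree] at h3
    have := hf (f v)
    omega
  have h4 := Finset.card_nsmul_le_sum Finset.univ (fun v => 2 * G.degree v) (Fintype.card V)
    fun v _ => h1 v
  rw [← Finset.mul_sum, sum_degrees_eq_twice_card_edges, smul_eq_mul, Finset.card_univ] at h4
  rw [Set.ncard_eq_toFinset_card', pow_two]
  change _ ≤ 4 * G.edgeFinset.card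
  omega

lemma closeToSplit_of_splitPair {ι : Type*} {A : ι → Finset V} {g : ι → ℕ} {R B : SimpleGraph ι}
    {E : Finset (V × V)} {X Y : Set ι} {δ : ℝ}
    (hd : ∀ x y, x ≠ y → Disjoint (A x) (A y))
    (hE : ∀ u v, (u, v) ∉ E → G.Adj u v → ∃ x y, u ∈ A x ∧ v ∈ A y ∧ g x ≠ g y ∧
      (¬ R.Adj x y → c s(u, v) = false) ∧ (¬ B.Adj x y → c s(u, v) = true))
    (h : SplitPair R B g X Y) (hEc : (E.card : ℝ) ≤ δ * G.edgeSet.ncard) :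
    CloseToSplit G c δ := by
  set F : Set (Sym2 V) := {e | e ∈ G.edgeSet ∧ e ∈ E.image fun p => s(p.1, p.2)} with hF
  have hFc : (F.ncard : ℝ) ≤ E.card := by
    have h1 : F ⊆ (E.image fun p => s(p.1, p.2) : Finset (Sym2 V)) := fun e he => he.2
    have h2 := Set.ncard_le_ncard h1 (Finset.finite_toSet _)
    rw [Set.ncard_coe_finset] at h2
    exact_mod_cast h2.trans Finset.card_image_le
  set Q : Set V := {v | ∃ x, v ∈ A x ∧ x ∉ X ∧ x ∉ Y} with hQ
  set S : Set V := {v | ∃ x, v ∈ A x ∧ x ∈ X ∧ x ∉ Y} with hS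
  set T : Set V := {v | ∃ x, v ∈ A x ∧ x ∉ X ∧ x ∈ Y} with hT
  have huniq : ∀ {v x y}, v ∈ A x → v ∈ A y → x = y := by
    intro v x y hx hy
    by_contra hne
    exact Finset.disjoint_left.1 (hd x y hne) hx hy
  have mem (p : ι → Prop) {v x} (hv : v ∈ A x) : (∃ x, v ∈ A x ∧ p x) ↔ p x :=
    ⟨fun ⟨y, hy, hp⟩ => huniq hv hy ▸ hp, fun hp => ⟨x, hv, hp⟩⟩
  have memQ {v x} (hv : v ∈ A x) : v ∈ Q ↔ x ∉ X ∧ x ∉ Y := mem _ hv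
  have memS {v x} (hv : v ∈ A x) : v ∈ S ↔ x ∈ X ∧ x ∉ Y := mem _ hv
  have memT {v x} (hv : v ∈ A x) : v ∈ T ↔ x ∉ X ∧ x ∈ Y := mem _ hv
  have hQS : ∀ v, v ∈ Q → v ∉ S := fun v ⟨x, hv, hx⟩ h => hx.1 ((memS hv).1 h).1
  have hQT : ∀ v, v ∈ Q → v ∉ T := fun v ⟨x, hv, hx⟩ h => hx.2 ((memT hv).1 h).2
  have hST : ∀ v, v ∈ S → v ∉ T := fun v ⟨x, hv, hx⟩ h => hx.2 ((memT hv).1 h).2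
  have hadj : ∀ {u v}, (G.deleteEdges F).Adj u v → ∃ x y, u ∈ A x ∧ v ∈ A y ∧ g x ≠ g y ∧
      (¬ R.Adj x y → c s(u, v) = false) ∧ (¬ B.Adj x y → c s(u, v) = true) := by
    intro u v huv
    rw [deleteEdges_adj] at huv
    exact hE u v (fun hm => huv.2 ⟨huv.1, Finset.mem_image_of_mem (fun p => s(p.1, p.2)) hm⟩) huv.1
  obtain ⟨hX, hY, hXY⟩ := h
  refine ⟨F, fun e he => he.1, hFc.trans hEc, (Q ∪ S ∪ T)ᶜ ∪ Q, T ∪ S, ?_, ?_, ?_,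
    (Q ∪ S ∪ T)ᶜ, Q, T, S, rfl, ?_, rfl, ?_, ?_, ?_⟩
  · ext v
    simp only [Set.mem_union, Set.mem_compl_iff, Set.mem_univ, iff_true]
    tauto
  · rw [Set.disjoint_left]
    intro v
    have := hQS v
    have := hQT v
    simp only [Set.mem_union, Set.mem_compl_iff]
    tauto
  · intro u v huv
    obtain ⟨x, y, hu, hv, hg, -⟩ := hadj huv
    have := hXY x y hg
    simp only [Set.mem_union, Set.mem_compl_iff, memQ hu, memQ hv, memS hu, memS hv, memT hu,
      memT hv]
    tauto
  · rw [Set.disjoint_left]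
    intro v
    simp only [Set.mem_union, Set.mem_compl_iff]
    tauto
  · rw [Set.disjoint_left]
    exact fun v h1 h2 => hST v h2 h1
  · intro u v huv huv'
    obtain ⟨x, y, hu, hv, hg, hR, -⟩ := hadj huv
    refine hR fun hxy => ?_
    have := hX x y hxy
    simp only [Set.mem_union, Set.mem_compl_iff, memQ hu, memQ hv, memS hu, memS hv, memT hu,
      memT hv] at huv'
    tauto
  · intro u v huv huv'
    obtain ⟨x, y, hu, hv, hg, -, hB⟩ := hadj huv
    refine hB fun hxy => ?_
    have := hY x y hxy
    simp only [Set.mem_union, Set.mem_compl_iff, memQ hu, memQ hv, memS hu, memS hv, memT hu,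
      memT hv] at huv'
    tauto

end Close

/-- For every `δ > 0` there is `n₀` such that every fair complete `k`-partite graph
(`k ≥ 2`) on more than `n₀` vertices whose red/blue colouring is not `δ`-close to a
split colouring contains a red cycle and a blue cycle, vertex-disjoint, which together
cover all but at most `δn` vertices. -/
theorem stmt2 (δ : ℝ) (hδ : 0 < δ) :
    ∃ n₀ : ℕ, ∀ (V : Type) [Fintype V],
      ∀ (k : ℕ) (f : V → Fin k) (G : SimpleGraph V) (c : Sym2 V → Bool),
        2 ≤ k → Function.Surjective f → (∀ x y, G.Adj x y ↔ f x ≠ f y) →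
        (∀ i : Fin k, 2 * ({v | f v = i} : Set V).ncard ≤ Fintype.card V) →
        n₀ < Fintype.card V → ¬ CloseToSplit G c δ →
        ∃ S T : Set V, IsMonoCycleSet G c true S ∧ IsMonoCycleSet G c false T ∧
          Disjoint S T ∧
          ((Set.univ \ (S ∪ T)).ncard : ℝ) ≤ δ * (Fintype.card V : ℝ) := by
  classical
  set d : ℝ := min δ 1 with hd
  have hd0 : 0 < d := lt_min hδ one_pos
  have hd1 : d ≤ 1 := min_le_right _ _
  obtain ⟨n₀, hn₀⟩ := exists_isReduction (η := d / 1280) (ρ := d / 100) (by positivity)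
    (by linarith) (by positivity) (by linarith)
  refine ⟨n₀, fun V _ k f G c _ _ hG hf hn hclose => ?_⟩
  have hf' : ∀ i, 2 * (Finset.univ.filter (f · = i)).card ≤ Fintype.card V := by
    intro i
    rw [← Set.ncard_coe_finset]
    simpa using hf i
  obtain ⟨ι, _, A, g, R, B, E, s, t, h⟩ := hn₀ V (Fin k) f G c hG hf' hn
  have hn0 : (0 : ℝ) < Fintype.card V := by
    have : 0 < Fintype.card V := by omega
    exact_mod_cast this
  have hcov := h.le_card_mul
  have hpos : (0 : ℝ) < Fintype.card ι * s :=
    lt_of_lt_of_le (mul_pos (by linarith) hn0) hcov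
  have hι : Nonempty ι := by
    by_contra hι
    rw [not_nonempty_iff] at hι
    simp at hpos
  have ht := h.le_mul
  have hts : 20 * t ≤ s := by
    have h1 : (20 * t : ℝ) ≤ s := by
      have : d / 100 * s ≤ 1 / 20 * s := by
        gcongr
        linarith
      linarith
    exact_mod_cast h1
  rcases h.nearlyComplete.expandingPair_or_splitPair (δ := d / 4) (by linarith) (by positivity)
    (by linarith) with hexp | ⟨X, Y, hXY⟩
  · obtain ⟨S, T, hS, hT, hST, hc⟩ := exists_cycles_of_hasExpandingPair h.disjoint h.card_eq h.red
      h.blue hexp (by positivity) h.sq_card_le h.one_le hts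
    refine ⟨S, T, hS, hT, Finset.disjoint_coe.2 hST, ?_⟩
    have h1 : (Set.univ \ ((S : Set V) ∪ T)).ncard + (S.card + T.card) = Fintype.card V := by
      rw [← Finset.card_union_of_disjoint hST, ← Finset.coe_union, ← Finset.coe_univ,
        ← Finset.coe_sdiff, Set.ncard_coe_finset, ← Finset.card_univ]
      exact Finset.card_sdiff_add_card_eq_card (Finset.subset_univ _)
    have h2 : ((Set.univ \ ((S : Set V) ∪ T)).ncard : ℝ) + (S.card + T.card) = Fintype.card V := by
      exact_mod_cast h1
    have h3 : (1 - d / 4) * Fintype.card ι * ((1 - 15 * (d / 100)) * s) ≤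
        (1 - d / 4) * Fintype.card ι * (s - 15 * t) :=
      mul_le_mul_of_nonneg_left (by linarith)
        (mul_nonneg (by linarith) (Nat.cast_nonneg _))
    have h4 : (1 - d / 4) * (1 - 15 * (d / 100)) * ((1 - 3 * (d / 1280)) * Fintype.card V) ≤
        (1 - d / 4) * (1 - 15 * (d / 100)) * (Fintype.card ι * s) :=
      mul_le_mul_of_nonneg_left hcov (mul_nonneg (by linarith) (by linarith))
    have h5 : (1 - d) * Fintype.card V ≤
        (1 - d / 4) * (1 - 15 * (d / 100)) * (1 - 3 * (d / 1280)) * (Fintype.card V : ℝ) := by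
      gcongr
      have : 1 - d / 2 ≤ (1 - d / 4) * (1 - 15 * (d / 100)) := by nlinarith
      nlinarith
    have h6 : d * Fintype.card V ≤ δ * Fintype.card V := by
      gcongr
      exact min_le_left _ _
    linarith
  · refine absurd (closeToSplit_mono (closeToSplit_of_splitPair (δ := d) h.disjoint h.exists_mem
      hXY ?_) (min_le_left _ _)) hclose
    have h1 : (Fintype.card V : ℝ) ^ 2 ≤ 4 * G.edgeSet.ncard := by
      exact_mod_cast sq_card_le_four_mul_ncard_edgeSet hG fun i => by convert hf' i
    have h2 := mul_le_mul_of_nonneg_left h1 hd0.le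
    have h3 : 20 * (d / 1280) * (Fintype.card V : ℝ) ^ 2 ≤ d * Fintype.card V ^ 2 / 4 := by
      have : 0 ≤ d * (Fintype.card V : ℝ) ^ 2 := by positivity
      linarith
    linarith [h.card_exceptional]
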